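/- Let W ⊆ ℂ be a bounded, open, connected, simply connected set and w ∈ W. Then there exists a Carathéodory modulus η : (0,a) → ℝ for (W,w) with η(r) → 0 as r → 0⁺ if and only if ∂W, with its subspace topology from ℂ, is locally connected. -/

import Mathlib

/-- A crosscut of `W`: a continuous injective map `γ : [0,1] → ℂ` with
`γ(t) ∈ W` for `t ∈ (0,1)` and endpoints on `∂W`. -/
def IsCrosscut (W : Set ℂ) (γ : ℝ → ℂ) : Prop :=
  ContinuousOn γ (Set.Icc 0 1) ∧ Set.InjOn γ (Set.Icc 0 1) ∧
    (∀ t ∈ Set.Ioo (0:ℝ) 1, γ t ∈ W) ∧ γ 0 ∈ frontier W ∧ γ 1 ∈ frontier W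

/-- The crosscut neighborhood `N_γ`: the union of the connected components of
`W \ γ((0,1))` which do not contain the base point `w`. -/
def crosscutNbhd (W : Set ℂ) (w : ℂ) (γ : ℝ → ℂ) : Set ℂ :=
  {z | z ∈ W \ γ '' Set.Ioo 0 1 ∧ w ∉ connectedComponentIn (W \ γ '' Set.Ioo 0 1) z}

/-- A Carathéodory modulus for `(W, w)`: a strictly increasing `η : (0,a) → ℝ` such
that every crosscut `γ` avoiding `w` with `diam γ([0,1]) < r < a` has
`diam N_γ < η r`. -/
def IsCaratheodoryModulus (W : Set ℂ) (w : ℂ) (a : ℝ) (η : ℝ → ℝ) : Prop :=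
  StrictMonoOn η (Set.Ioo 0 a) ∧
    ∀ γ : ℝ → ℂ, IsCrosscut W γ → w ∉ γ '' Set.Ioo 0 1 →
      ∀ r : ℝ, Metric.diam (γ '' Set.Icc 0 1) < r → r < a →
        Metric.diam (crosscutNbhd W w γ) < η r

section

open Set Metric Filter Topology MeasureTheory

theorem exists_tendstoLocallyUniformlyOn_ultrafilter {U : Set ℂ} (hU : IsOpen U)
    {F : ℕ → ℂ → ℂ} (hd : ∀ n, DifferentiableOn ℂ (F n) U)
    (hb : ∀ n, MapsTo (F n) U (closedBall 0 1)) (φ : Ultrafilter ℕ) :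
    ∃ f : ℂ → ℂ, TendstoLocallyUniformlyOn F f (φ : Filter ℕ) U := by
  have hlim : ∀ z : ℂ, ∃ y : ℂ, z ∈ U → Tendsto (fun n ↦ F n z) φ (𝓝 y) := by
    intro z
    by_cases hz : z ∈ U
    · obtain ⟨y, -, hy⟩ := (isCompact_closedBall (0 : ℂ) 1).ultrafilter_le_nhds
        (φ.map fun n ↦ F n z) (by
          rw [le_principal_iff]
          exact mem_map.2 (Filter.univ_mem' fun n ↦ hb n hz))
      exact ⟨y, fun _ ↦ hy⟩
    · exact ⟨0, fun h ↦ absurd h hz⟩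
  choose f hf using hlim
  refine ⟨f, ?_⟩
  rw [Metric.tendstoLocallyUniformlyOn_iff]
  intro ε hε x hx
  obtain ⟨R, hR, hRU⟩ := Metric.isOpen_iff.1 hU x hx
  have hlip : ∀ n, ∀ z ∈ ball x R, dist (F n z) (F n x) ≤ 2 / R * dist z x := by
    intro n z hz
    refine Complex.dist_le_div_mul_dist_of_mapsTo_ball ((hd n).mono hRU) ?_ hz
    intro y hy
    have h1 := hb n (hRU hy)
    have h2 := hb n hx
    rw [mem_closedBall, dist_zero_right] at h1 h2
    rw [mem_closedBall, dist_eq_norm]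
    exact (norm_sub_le _ _).trans (by linarith)
  have hlipf : ∀ z ∈ ball x R, dist (f z) (f x) ≤ 2 / R * dist z x := fun z hz ↦
    le_of_tendsto ((hf z (hRU hz)).dist (hf x hx)) (Eventually.of_forall fun n ↦ hlip n z hz)
  have hδ : 0 < min R (R * ε / 6) := by positivity
  refine ⟨ball x (min R (R * ε / 6)), mem_nhdsWithin_of_mem_nhds (ball_mem_nhds _ hδ), ?_⟩
  filter_upwards [Metric.tendsto_nhds.1 (hf x hx) (ε / 3) (by positivity)] with n hn y hy
  have hyR : y ∈ ball x R := ball_subset_ball (min_le_left _ _) hy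
  have hsmall : 2 / R * dist y x < ε / 3 := by
    have : dist y x < R * ε / 6 := lt_of_lt_of_le hy (min_le_right _ _)
    calc 2 / R * dist y x < 2 / R * (R * ε / 6) := by gcongr
      _ = ε / 3 := by field_simp; norm_num
  have h1 := hlip n y hyR
  have h2 := hlipf y hyR
  have h3 := dist_triangle4 (f y) (f x) (F n x) (F n y)
  rw [dist_comm (f x), dist_comm (F n x) (F n y)] at h3
  linarith

theorem eventually_ne_of_not_const {U : Set ℂ} (hU : IsOpen U) (hUc : IsPreconnected U)
    {f : ℂ → ℂ} (hf : DifferentiableOn ℂ f U) {w : ℂ} (hw : w ∈ U) (hdw : deriv f w ≠ 0)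
    {a : ℂ} (ha : a ∈ U) : ∀ᶠ z in 𝓝[≠] a, f z ≠ f a := by
  have han : AnalyticOnNhd ℂ f U := hf.analyticOnNhd hU
  rcases (han a ha).eventually_eq_or_eventually_ne analyticAt_const (g := fun _ ↦ f a) with h | h
  · exfalso
    have heq := han.eqOn_of_preconnected_of_eventuallyEq (g := fun _ ↦ f a)
      (fun _ _ ↦ analyticAt_const) hUc ha h
    apply hdw
    have : f =ᶠ[𝓝 w] fun _ ↦ f a := heq.eventuallyEq_of_mem (hU.mem_nhds hw)
    rw [this.deriv_eq, deriv_const]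
  · exact h

/-- Hurwitz: a nonconstant locally uniform limit of injective holomorphic maps is injective. -/
theorem injOn_of_tendstoLocallyUniformlyOn {ι : Type*} {φ : Filter ι} [φ.NeBot]
    {U : Set ℂ} (hU : IsOpen U) (hUc : IsPreconnected U) {F : ι → ℂ → ℂ} {f : ℂ → ℂ}
    (hF : TendstoLocallyUniformlyOn F f φ U) (hd : ∀ n, DifferentiableOn ℂ (F n) U)
    (hinj : ∀ n, InjOn (F n) U) {w : ℂ} (hw : w ∈ U) (hdw : deriv f w ≠ 0) : InjOn f U := by
  have hfd : DifferentiableOn ℂ f U := hF.differentiableOn (Eventually.of_forall hd) hU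
  intro a ha b hb hab
  by_contra hne
  have hev := eventually_ne_of_not_const hU hUc hfd hw hdw ha
  rw [eventually_nhdsWithin_iff] at hev
  obtain ⟨r₁, hr₁, h₁⟩ := Metric.eventually_nhds_iff_ball.1 (hev.and (hU.mem_nhds ha))
  obtain ⟨r, hr, hrlt⟩ : ∃ r, 0 < r ∧ r < min r₁ (dist a b) :=
    exists_between (lt_min hr₁ (dist_pos.2 hne))
  have hcb : closedBall a r ⊆ U := fun z hz ↦
    (h₁ z (lt_of_le_of_lt hz (hrlt.trans_le (min_le_left _ _)))).2
  have hbr : b ∉ closedBall a r := by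
    rw [mem_closedBall, not_le, dist_comm]
    exact hrlt.trans_le (min_le_right _ _)
  have hsph : ∀ z ∈ sphere a r, 0 < ‖f z - f a‖ := by
    intro z hz
    rw [norm_pos_iff, sub_ne_zero]
    refine (h₁ z ?_).1 ?_
    · rw [mem_ball, mem_sphere.1 hz]; exact hrlt.trans_le (min_le_left _ _)
    · rintro rfl
      simp at hz
      exact hr.ne hz
  obtain ⟨m, hm, hmle⟩ : ∃ m, 0 < m ∧ ∀ z ∈ sphere a r, m ≤ ‖f z - f a‖ := by
    have hc : ContinuousOn (fun z ↦ ‖f z - f a‖) (sphere a r) :=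
      ((hfd.continuousOn.mono (sphere_subset_closedBall.trans hcb)).sub continuousOn_const).norm
    obtain ⟨z₀, hz₀, hmin⟩ := (isCompact_sphere a r).exists_isMinOn
      ((NormedSpace.sphere_nonempty (x := a) (r := r)).2 hr.le) hc
    exact ⟨_, hsph z₀ hz₀, fun z hz ↦ hmin hz⟩
  have hK : closedBall a r ∪ {b} ⊆ U := union_subset hcb (singleton_subset_iff.2 hb)
  have hunif := (tendstoLocallyUniformlyOn_iff_forall_isCompact hU).1 hF _ hK
    ((isCompact_closedBall a r).union isCompact_singleton)
  obtain ⟨n, hn⟩ := (Metric.tendstoUniformlyOn_iff.1 hunif (m / 8) (by positivity)).exists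
  have hna := hn a (Or.inl (mem_closedBall_self hr.le))
  have hnb := hn b (Or.inr rfl)
  have hdc : DiffContOnCl ℂ (F n) (ball a r) := by
    apply DifferentiableOn.diffContOnCl
    rw [closure_ball a hr.ne']
    exact (hd n).mono hcb
  have himg := hdc.ball_subset_image_closedBall (ε := m / 2) hr (by
    intro z hz
    have hnz := hn z (Or.inl (sphere_subset_closedBall hz))
    have := hmle z hz
    rw [← dist_eq_norm] at this ⊢
    have h4 := dist_triangle4 (f z) (F n z) (F n a) (f a)
    rw [dist_comm (F n a) (f a)] at h4
    linarith) (by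
    apply Eventually.frequently (f := 𝓝[≠] a) _ |>.filter_mono nhdsWithin_le_nhds
    filter_upwards [self_mem_nhdsWithin, nhdsWithin_le_nhds (hU.mem_nhds ha)] with z hz hzU h
    exact hz (hinj n hzU ha h))
  obtain ⟨z, hz, hzb⟩ := himg (show F n b ∈ ball (F n a) (m / 2 / 2) by
    rw [mem_ball]
    have h4 := dist_triangle4 (F n b) (f b) (f a) (F n a)
    rw [dist_comm (F n b) (f b), hab, dist_self] at h4
    rw [hab] at hna
    linarith)
  exact hbr (hinj n (hcb hz) hb hzb ▸ hz)

/-- An injective holomorphic map has a holomorphic inverse. -/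
theorem exists_differentiableOn_inverse {U : Set ℂ} (hU : IsOpen U) (hUc : IsPreconnected U)
    {f : ℂ → ℂ} (hf : DifferentiableOn ℂ f U) (hinj : InjOn f U) {w : ℂ} (hw : w ∈ U)
    (hdw : deriv f w ≠ 0) :
    ∃ g : ℂ → ℂ, DifferentiableOn ℂ g (f '' U) ∧ InvOn g f U (f '' U) ∧ MapsTo g (f '' U) U := by
  have han : AnalyticOnNhd ℂ f U := hf.analyticOnNhd hU
  have hopen : ∀ s ⊆ U, IsOpen s → IsOpen (f '' s) := by
    rcases han.is_constant_or_isOpen hUc with ⟨c, hc⟩ | h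
    · exfalso
      apply hdw
      have : f =ᶠ[𝓝 w] fun _ ↦ c := eventuallyEq_of_mem (hU.mem_nhds hw) hc
      rw [this.deriv_eq, deriv_const]
    · exact h
  set g := Function.invFunOn f U with hg
  have hleft : LeftInvOn g f U := hinj.leftInvOn_invFunOn
  have hmaps : MapsTo g (f '' U) U := by
    rintro _ ⟨z, hz, rfl⟩
    rwa [hleft hz]
  have hright : RightInvOn g f (f '' U) := by
    rintro _ ⟨z, hz, rfl⟩
    rw [hleft hz]
  have hfU := hopen U subset_rfl hU
  have hcont : ∀ z ∈ U, ContinuousAt g (f z) := by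
    intro z hz
    rw [ContinuousAt, hleft hz]
    intro s hs
    have hs' : interior s ∩ U ⊆ U := inter_subset_right
    refine mem_map.2 (mem_of_superset ((hopen _ hs' (isOpen_interior.inter hU)).mem_nhds
      ⟨z, ⟨mem_interior_iff_mem_nhds.2 hs, hz⟩, rfl⟩) ?_)
    rintro _ ⟨y, hy, rfl⟩
    rw [mem_preimage, hleft hy.2]
    exact interior_subset hy.1
  have hdiff : ∀ z ∈ U, deriv f z ≠ 0 → DifferentiableAt ℂ g (f z) := by
    intro z hz hdz
    have h1 : HasDerivAt f (deriv f z) (g (f z)) := by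
      rw [hleft hz]
      exact (hf.differentiableAt (hU.mem_nhds hz)).hasDerivAt
    exact (HasDerivAt.of_local_left_inverse (hcont z hz) h1 hdz
      (eventually_of_mem (hfU.mem_nhds ⟨z, hz, rfl⟩) hright)).differentiableAt
  refine ⟨g, ?_, ⟨hleft, hright⟩, hmaps⟩
  rintro _ ⟨z, hz, rfl⟩
  apply DifferentiableAt.differentiableWithinAt
  have hd_an : AnalyticOnNhd ℂ (deriv f) U := han.deriv
  have hev : ∀ᶠ y in 𝓝[≠] z, deriv f y ≠ 0 := by
    rcases (hd_an z hz).eventually_eq_zero_or_eventually_ne_zero with h | h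
    · exact absurd (hd_an.eqOn_zero_of_preconnected_of_eventuallyEq_zero hUc hz h hw) hdw
    · exact h
  rw [eventually_nhdsWithin_iff] at hev
  obtain ⟨s, hsub, hso, hzs⟩ := _root_.mem_nhds_iff.1 (inter_mem hev (hU.mem_nhds hz))
  have hsU : s ⊆ U := fun y hy ↦ (hsub hy).2
  have hnhds : f '' s ∈ 𝓝 (f z) := (hopen s hsU hso).mem_nhds ⟨z, hzs, rfl⟩
  refine ((Complex.differentiableOn_compl_singleton_and_continuousAt_iff hnhds).1
    ⟨?_, hcont z hz⟩).differentiableAt hnhds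
  rintro _ ⟨⟨y, hy, rfl⟩, hyz⟩
  refine (hdiff y (hsU hy) ((hsub hy).1 ?_)).differentiableWithinAt
  rintro rfl
  exact hyz rfl

/-- The disc automorphism sending `a` to `0`. -/
noncomputable def discMoebius (a z : ℂ) : ℂ := (z - a) / (1 - starRingEnd ℂ a * z)

theorem one_sub_conj_mul_ne_zero {a z : ℂ} (ha : ‖a‖ < 1) (hz : ‖z‖ < 1) :
    1 - starRingEnd ℂ a * z ≠ 0 := by
  intro h
  have h1 : ‖starRingEnd ℂ a * z‖ = 1 := by rw [← sub_eq_zero.1 h, norm_one]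
  rw [norm_mul, RCLike.norm_conj] at h1
  nlinarith [norm_nonneg a, norm_nonneg z]

theorem norm_discMoebius_lt_one {a z : ℂ} (ha : ‖a‖ < 1) (hz : ‖z‖ < 1) :
    ‖discMoebius a z‖ < 1 := by
  rw [discMoebius, norm_div, div_lt_one (norm_pos_iff.2 (one_sub_conj_mul_ne_zero ha hz))]
  apply lt_of_pow_lt_pow_left₀ 2 (norm_nonneg _)
  have ha2 : ‖a‖ ^ 2 < 1 := by nlinarith [norm_nonneg a]
  have hz2 : ‖z‖ ^ 2 < 1 := by nlinarith [norm_nonneg z]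
  rw [← Complex.normSq_eq_norm_sq, Complex.normSq_apply] at *
  rw [← Complex.normSq_eq_norm_sq, Complex.normSq_apply] at *
  simp only [Complex.sub_re, Complex.sub_im, Complex.one_re, Complex.one_im, Complex.mul_re,
    Complex.mul_im, Complex.conj_re, Complex.conj_im] at *
  nlinarith [mul_pos (sub_pos.2 ha2) (sub_pos.2 hz2)]

theorem discMoebius_injOn {a : ℂ} (ha : ‖a‖ < 1) : InjOn (discMoebius a) (ball 0 1) := by
  intro z hz y hy h
  rw [mem_ball_zero_iff] at hz hy
  have h1 := one_sub_conj_mul_ne_zero ha hz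
  have h2 := one_sub_conj_mul_ne_zero ha hy
  have h3 := one_sub_conj_mul_ne_zero ha ha
  rw [discMoebius, discMoebius, div_eq_div_iff h1 h2] at h
  have : (1 - starRingEnd ℂ a * a) * (z - y) = 0 := by linear_combination h
  rcases mul_eq_zero.1 this with h | h
  · exact absurd h h3
  · exact sub_eq_zero.1 h

theorem hasDerivAt_discMoebius {a z : ℂ} (ha : ‖a‖ < 1) (hz : ‖z‖ < 1) :
    HasDerivAt (discMoebius a)
      ((1 - starRingEnd ℂ a * a) / (1 - starRingEnd ℂ a * z) ^ 2) z := by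
  have h1 := one_sub_conj_mul_ne_zero ha hz
  have := ((hasDerivAt_id z).sub_const a).div
    (((hasDerivAt_id z).const_mul (starRingEnd ℂ a)).const_sub 1) h1
  refine this.congr_deriv ?_
  simp only [id]
  ring

/-- A continuous square root of a nonvanishing holomorphic function is holomorphic. -/
theorem hasDerivAt_of_sq_eq {f g : ℂ → ℂ} {z f' : ℂ} (hf : HasDerivAt f f' z)
    (hg : ContinuousAt g z) (hne : g z ≠ 0) (hsq : ∀ y, g y ^ 2 = f y) :
    HasDerivAt g (f' / (2 * g z)) z := by
  rw [hasDerivAt_iff_tendsto_slope] at hf ⊢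
  have hsum : Tendsto (fun y ↦ g y + g z) (𝓝[≠] z) (𝓝 (2 * g z)) := by
    rw [two_mul]
    exact (hg.tendsto.mono_left nhdsWithin_le_nhds).add_const _
  have hne2 : 2 * g z ≠ 0 := mul_ne_zero two_ne_zero hne
  refine (hf.div hsum hne2).congr' ?_
  filter_upwards [hsum.eventually_ne hne2] with y hy
  rw [Pi.div_apply, slope_def_field, slope_def_field, ← hsq, ← hsq]
  field_simp
  ring

/-- Injective holomorphic maps of `U` to the unit disc that send `w` to `0`. -/
def IsDiscEmbedding (U : Set ℂ) (w : ℂ) (f : ℂ → ℂ) : Prop :=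
  DifferentiableOn ℂ f U ∧ InjOn f U ∧ MapsTo f U (ball 0 1) ∧ f w = 0

theorem IsDiscEmbedding.exists_deriv_gt {U : Set ℂ} {w : ℂ} {f : ℂ → ℂ}
    (hf : IsDiscEmbedding U w f) (hU : IsOpen U) (hUs : IsSimplyConnected U) (hw : w ∈ U)
    (hdw : deriv f w ≠ 0) {a : ℂ} (ha : ‖a‖ < 1) (hna : a ∉ f '' U) :
    ∃ h, IsDiscEmbedding U w h ∧ ‖deriv f w‖ < ‖deriv h w‖ := by
  obtain ⟨hfd, hfi, hfm, hfw⟩ := hf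
  have hfn : ∀ z ∈ U, ‖f z‖ < 1 := fun z hz ↦ mem_ball_zero_iff.1 (hfm hz)
  set p : ℂ → ℂ := fun z ↦ discMoebius a (f z) with hp
  have hpd : ∀ z ∈ U, HasDerivAt p ((1 - starRingEnd ℂ a * a) / (1 - starRingEnd ℂ a * f z) ^ 2 *
      deriv f z) z := fun z hz ↦ (hasDerivAt_discMoebius ha (hfn z hz)).comp z
        (hfd.differentiableAt (hU.mem_nhds hz)).hasDerivAt
  have hp0 : ∀ z ∈ U, p z ≠ 0 := by
    intro z hz h
    rcases div_eq_zero_iff.1 h with h | h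
    · exact hna ⟨z, hz, sub_eq_zero.1 h⟩
    · exact one_sub_conj_mul_ne_zero ha (hfn z hz) h
  obtain ⟨g, hgc, hg⟩ := Complex.exists_continuousOn_pow_eq hUs hU (g := p)
    (fun z hz ↦ (hpd z hz).continuousAt.continuousWithinAt)
    (by rintro ⟨z, hz, h⟩; exact hp0 z hz h) two_ne_zero
  have hg0 : ∀ z ∈ U, g z ≠ 0 := by
    intro z hz h
    apply hp0 z hz
    rw [← hg, h]; simp
  have hgn : ∀ z ∈ U, ‖g z‖ < 1 := by
    intro z hz
    have h1 : ‖g z‖ ^ 2 < 1 := by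
      rw [← norm_pow, hg]; exact norm_discMoebius_lt_one ha (hfn z hz)
    by_contra! h
    nlinarith
  have hgd : ∀ z ∈ U, HasDerivAt g _ z := fun z hz ↦
    hasDerivAt_of_sq_eq (hpd z hz) (hgc.continuousAt (hU.mem_nhds hz)) (hg0 z hz) hg
  set b := g w with hb
  have hbn : ‖b‖ < 1 := hgn w hw
  have hb0 : b ≠ 0 := hg0 w hw
  have hba : b ^ 2 = -a := by rw [hb, hg, hp]; simp [discMoebius, hfw]
  have hhd : ∀ z ∈ U, HasDerivAt (fun z ↦ discMoebius b (g z)) _ z := fun z hz ↦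
    (hasDerivAt_discMoebius hbn (hgn z hz)).comp z (hgd z hz)
  refine ⟨fun z ↦ discMoebius b (g z), ⟨fun z hz ↦
    (hhd z hz).differentiableAt.differentiableWithinAt, ?_, fun z hz ↦
    mem_ball_zero_iff.2 (norm_discMoebius_lt_one hbn (hgn z hz)), by simp [discMoebius, hb]⟩, ?_⟩
  · intro z hz y hy h
    have h1 := discMoebius_injOn hbn (mem_ball_zero_iff.2 (hgn z hz))
      (mem_ball_zero_iff.2 (hgn y hy)) h
    have h2 : p z = p y := by rw [← hg, ← hg, h1]
    exact hfi hz hy (discMoebius_injOn ha (hfm hz) (hfm hy) h2)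
  · rw [(hhd w hw).deriv, hfw, ← hb]
    have hconj : starRingEnd ℂ a * a = (starRingEnd ℂ b * b) ^ 2 := by
      rw [← neg_neg a, ← hba]; simp; ring
    rw [hconj]
    have h3 := one_sub_conj_mul_ne_zero hbn hbn
    have h4 : (1 - starRingEnd ℂ b * b) / (1 - starRingEnd ℂ b * b) ^ 2 *
        ((1 - (starRingEnd ℂ b * b) ^ 2) / (1 - starRingEnd ℂ a * 0) ^ 2 * deriv f w / (2 * b)) =
        (1 + starRingEnd ℂ b * b) / (2 * b) * deriv f w := by
      rw [mul_zero, sub_zero]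
      field_simp
      ring
    rw [h4, norm_mul]
    have h5 : ‖(1 + starRingEnd ℂ b * b) / (2 * b)‖ = (1 + ‖b‖ ^ 2) / (2 * ‖b‖) := by
      rw [norm_div, norm_mul, Complex.norm_two, mul_comm, Complex.mul_conj,
        Complex.normSq_eq_norm_sq, ← Complex.ofReal_one, ← Complex.ofReal_add, Complex.norm_real,
        Real.norm_of_nonneg (by positivity)]
    have h6 : 1 < (1 + ‖b‖ ^ 2) / (2 * ‖b‖) := by
      have hbpos : 0 < ‖b‖ := norm_pos_iff.2 hb0
      rw [one_lt_div (by positivity)]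
      nlinarith [mul_pos (sub_pos.2 hbn) (sub_pos.2 hbn)]
    rw [h5]
    nlinarith [norm_pos_iff.2 hdw]

theorem exists_isDiscEmbedding_deriv_max {U : Set ℂ} {w : ℂ} (hUb : Bornology.IsBounded U)
    (hU : IsOpen U) (hUc : IsPreconnected U) (hw : w ∈ U) :
    ∃ f, IsDiscEmbedding U w f ∧ deriv f w ≠ 0 ∧
      ∀ h, IsDiscEmbedding U w h → ‖deriv h w‖ ≤ ‖deriv f w‖ := by
  set S : Set ℝ := {x | ∃ h, IsDiscEmbedding U w h ∧ x = ‖deriv h w‖} with hS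
  obtain ⟨R, hR, hRU⟩ := hUb.subset_ball_lt 0 w
  have hmem : R⁻¹ ∈ S := by
    refine ⟨fun z ↦ (z - w) * (R : ℂ)⁻¹, ⟨by fun_prop, ?_, ?_, by simp⟩, ?_⟩
    · intro z _ y _ h
      simpa [hR.ne'] using h
    · intro z hz
      have := hRU hz
      rw [mem_ball, dist_eq_norm] at this
      rw [mem_ball_zero_iff, norm_mul, norm_inv, Complex.norm_real, Real.norm_of_nonneg hR.le,
        ← div_eq_mul_inv, div_lt_one hR]
      exact this
    · have : HasDerivAt (fun z : ℂ ↦ (z - w) * (R : ℂ)⁻¹) (1 * (R : ℂ)⁻¹) w :=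
        ((hasDerivAt_id w).sub_const w).mul_const _
      rw [this.deriv, one_mul, norm_inv, Complex.norm_real, Real.norm_of_nonneg hR.le]
  obtain ⟨r, hr, hrU⟩ := Metric.isOpen_iff.1 hU w hw
  have hbdd : BddAbove S := by
    refine ⟨1 / r, ?_⟩
    rintro _ ⟨h, ⟨hd, hi, hm, h0⟩, rfl⟩
    refine Complex.norm_deriv_le_div_of_mapsTo_ball (hd.mono hrU) ?_ hr
    rw [h0]
    exact fun z hz ↦ ball_subset_closedBall (hm (hrU hz))
  obtain ⟨u, -, hu, huS⟩ := exists_seq_tendsto_sSup ⟨_, hmem⟩ hbdd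
  choose F hF hFu using huS
  obtain ⟨f, hf⟩ := exists_tendstoLocallyUniformlyOn_ultrafilter hU (fun n ↦ (hF n).1)
    (fun n z hz ↦ ball_subset_closedBall ((hF n).2.2.1 hz)) (Filter.hyperfilter ℕ)
  have hle : (Filter.hyperfilter ℕ : Filter ℕ) ≤ atTop := Nat.hyperfilter_le_atTop
  have hpt : ∀ z ∈ U, Tendsto (fun n ↦ F n z) (Filter.hyperfilter ℕ) (𝓝 (f z)) :=
    fun z hz ↦ hf.tendsto_at hz
  have hderiv : Tendsto (fun n ↦ deriv (F n) w) (Filter.hyperfilter ℕ) (𝓝 (deriv f w)) :=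
    (hf.deriv (Eventually.of_forall fun n ↦ (hF n).1) hU).tendsto_at hw
  have hnorm : ‖deriv f w‖ = sSup S := by
    refine tendsto_nhds_unique hderiv.norm ?_
    simpa only [← hFu] using hu.mono_left hle
  have hpos : 0 < sSup S := (inv_pos.2 hR).trans_le (le_csSup hbdd hmem)
  have hdw : deriv f w ≠ 0 := norm_pos_iff.1 (hnorm ▸ hpos)
  have hfd : DifferentiableOn ℂ f U :=
    hf.differentiableOn (Eventually.of_forall fun n ↦ (hF n).1) hU
  have hfU : IsOpen (f '' U) := by
    rcases (hfd.analyticOnNhd hU).is_constant_or_isOpen hUc with ⟨c, hc⟩ | h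
    · exfalso
      apply hdw
      have : f =ᶠ[𝓝 w] fun _ ↦ c := eventuallyEq_of_mem (hU.mem_nhds hw) hc
      rw [this.deriv_eq, deriv_const]
    · exact h U subset_rfl hU
  refine ⟨f, ⟨hfd, injOn_of_tendstoLocallyUniformlyOn hU hUc hf (fun n ↦ (hF n).1)
    (fun n ↦ (hF n).2.1) hw hdw, ?_, ?_⟩, hdw, fun h hh ↦ ?_⟩
  · have hsub : f '' U ⊆ closedBall 0 1 := by
      rintro _ ⟨z, hz, rfl⟩
      exact isClosed_closedBall.mem_of_tendsto (hpt z hz)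
        (Eventually.of_forall fun n ↦ ball_subset_closedBall ((hF n).2.2.1 hz))
    have := hfU.subset_interior_iff.2 hsub
    rw [interior_closedBall _ one_ne_zero] at this
    exact mapsTo_iff_image_subset.2 this
  · refine tendsto_nhds_unique (hpt w hw) ?_
    simp only [(hF _).2.2.2]
    exact tendsto_const_nhds
  · rw [hnorm]
    exact le_csSup hbdd ⟨h, hh, rfl⟩

/-- The Riemann mapping theorem for bounded domains. -/
theorem exists_riemann_map {U : Set ℂ} {w : ℂ} (hUb : Bornology.IsBounded U)
    (hU : IsOpen U) (hUc : IsPreconnected U) (hUs : IsSimplyConnected U) (hw : w ∈ U) :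
    ∃ g f : ℂ → ℂ, DifferentiableOn ℂ g (ball 0 1) ∧ DifferentiableOn ℂ f U ∧
      MapsTo g (ball 0 1) U ∧ MapsTo f U (ball 0 1) ∧ (∀ x ∈ U, g (f x) = x) ∧
      (∀ v ∈ ball 0 1, f (g v) = v) ∧ g 0 = w := by
  obtain ⟨f, hf, hdw, hmax⟩ := exists_isDiscEmbedding_deriv_max hUb hU hUc hw
  have himg : f '' U = ball 0 1 := by
    refine (mapsTo_iff_image_subset.1 hf.2.2.1).antisymm fun a ha ↦ ?_
    by_contra hna
    obtain ⟨h, hh, hlt⟩ := hf.exists_deriv_gt hU hUs hw hdw (mem_ball_zero_iff.1 ha) hna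
    exact (hmax h hh).not_gt hlt
  obtain ⟨g, hgd, hinv, hgm⟩ := exists_differentiableOn_inverse hU hUc hf.1 hf.2.1 hw hdw
  rw [himg] at hgd hinv hgm
  refine ⟨g, f, hgd, hf.1, hgm, hf.2.2.1, fun x hx ↦ hinv.1 hx, fun v hv ↦ hinv.2 hv, ?_⟩
  rw [← hf.2.2.2, hinv.1 hw]

/-- `(z - p) / (z - q)` has a continuous logarithm on `X`. -/
def HasQuotientLog (X : Set ℂ) (p q : ℂ) : Prop :=
  ∃ L : ℂ → ℂ, ContinuousOn L X ∧ ∀ z ∈ X, Complex.exp (L z) = (z - p) / (z - q)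

theorem HasQuotientLog.symm {X : Set ℂ} {p q : ℂ} (h : HasQuotientLog X p q) :
    HasQuotientLog X q p := by
  obtain ⟨L, hL, hexp⟩ := h
  refine ⟨fun z ↦ -L z, hL.neg, fun z hz ↦ ?_⟩
  rw [Complex.exp_neg, hexp z hz, inv_div]

theorem HasQuotientLog.trans {X : Set ℂ} {p q r : ℂ} (hq : q ∉ X) (h : HasQuotientLog X p q)
    (h' : HasQuotientLog X q r) : HasQuotientLog X p r := by
  obtain ⟨L, hL, hexp⟩ := h
  obtain ⟨L', hL', hexp'⟩ := h'
  refine ⟨fun z ↦ L z + L' z, hL.add hL', fun z hz ↦ ?_⟩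
  have : z - q ≠ 0 := sub_ne_zero.2 fun h ↦ hq (h ▸ hz)
  rw [Complex.exp_add, hexp z hz, hexp' z hz, div_mul_div_cancel₀ this]

theorem hasQuotientLog_of_dist_lt {X : Set ℂ} {p q : ℂ} {r : ℝ} (hr : 0 < r)
    (hX : ∀ z ∈ X, r ≤ dist z p) (hpq : dist q p < r) : HasQuotientLog X q p := by
  have hne : ∀ z ∈ X, z - p ≠ 0 := by
    intro z hz h
    have := hX z hz
    rw [dist_eq_norm, h, norm_zero] at this
    linarith
  have heq : ∀ z ∈ X, (z - q) / (z - p) = 1 + (p - q) / (z - p) := by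
    intro z hz
    have := hne z hz
    field_simp
    ring
  have hmem : ∀ z ∈ X, (z - q) / (z - p) ∈ Complex.slitPlane := by
    intro z hz
    rw [heq z hz]
    apply Complex.mem_slitPlane_of_norm_lt_one
    rw [norm_div, div_lt_one (norm_pos_iff.2 (hne z hz)), ← dist_eq_norm, ← dist_eq_norm,
      dist_comm]
    exact hpq.trans_le (hX z hz)
  refine ⟨fun z ↦ Complex.log ((z - q) / (z - p)), ContinuousOn.clog ?_ hmem, fun z hz ↦
    Complex.exp_log (Complex.slitPlane_ne_zero (hmem z hz))⟩
  exact (continuousOn_id.sub continuousOn_const).div (continuousOn_id.sub continuousOn_const) hne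

theorem hasQuotientLog_of_isPreconnected {X S : Set ℂ} (hX : IsClosed X) (hS : IsPreconnected S)
    (hd : Disjoint S X) {p q : ℂ} (hp : p ∈ S) (hq : q ∈ S) : HasQuotientLog X p q := by
  refine hS.induction₂' (HasQuotientLog X) ?_ ?_ hp hq
  · intro x hx
    obtain ⟨r, hr, hrX⟩ := Metric.isOpen_iff.1 hX.isOpen_compl x (disjoint_left.1 hd hx)
    refine mem_nhdsWithin_of_mem_nhds (mem_of_superset (ball_mem_nhds x hr) fun y hy ↦ ?_)
    have h := hasQuotientLog_of_dist_lt (X := X) hr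
      (fun z hz ↦ not_lt.1 fun h ↦ hrX h hz) hy
    exact ⟨h.symm, h⟩
  · intro x y z _ hy _ h h'
    exact h.trans (disjoint_left.1 hd hy) h'

theorem eq_of_exp_eq_one {α : Type*} [TopologicalSpace α] {S : Set α} (hS : IsPreconnected S)
    {u : α → ℂ} (hu : ContinuousOn u S) (hexp : ∀ x ∈ S, Complex.exp (u x) = 1) {x y : α}
    (hx : x ∈ S) (hy : y ∈ S) : u x = u y := by
  have hrep : ∀ z ∈ S, ∃ n : ℤ, u z = n * (2 * Real.pi * Complex.I) := fun z hz ↦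
    Complex.exp_eq_one_iff.1 (hexp z hz)
  have him : ∀ (z : α) (n : ℤ), u z = n * (2 * Real.pi * Complex.I) →
      (u z).im / (2 * Real.pi) = n := by
    intro z n h
    have : (u z).im = n * (2 * Real.pi) := by rw [h]; simp
    rw [this]
    field_simp
  have hc : ContinuousOn (fun z ↦ (u z).im / (2 * Real.pi)) S :=
    (Complex.continuous_im.comp_continuousOn hu).div_const _
  have hmaps : MapsTo (fun z ↦ (u z).im / (2 * Real.pi)) S (range ((↑) : ℤ → ℝ)) := by
    intro z hz
    obtain ⟨n, hn⟩ := hrep z hz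
    exact ⟨n, (him z n hn).symm⟩
  have h := hS.constant_of_mapsTo
    Int.isClosedEmbedding_coe_real.isInducing.isDiscrete_range hc hmaps hx hy
  obtain ⟨n, hn⟩ := hrep x hx
  obtain ⟨m, hm⟩ := hrep y hy
  have h' : (u x).im / (2 * Real.pi) = (u y).im / (2 * Real.pi) := h
  rw [him x n hn, him y m hm] at h'
  rw [hn, hm, Int.cast_injective h']

theorem HasQuotientLog.union {X Y : Set ℂ} (hX : IsClosed X) (hY : IsClosed Y)
    (hXY : IsPreconnected (X ∩ Y)) {p q : ℂ} (hp : p ∉ X) (hq : q ∉ X)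
    (h : HasQuotientLog X p q) (h' : HasQuotientLog Y p q) : HasQuotientLog (X ∪ Y) p q := by
  classical
  obtain ⟨L, hL, hexp⟩ := h
  obtain ⟨L', hL', hexp'⟩ := h'
  have hone : ∀ z ∈ X ∩ Y, Complex.exp (L z - L' z) = 1 := by
    intro z hz
    have h1 : z - p ≠ 0 := sub_ne_zero.2 fun h ↦ hp (h ▸ hz.1)
    have h2 : z - q ≠ 0 := sub_ne_zero.2 fun h ↦ hq (h ▸ hz.1)
    rw [Complex.exp_sub, hexp z hz.1, hexp' z hz.2, div_self (div_ne_zero h1 h2)]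
  obtain ⟨k, hk, hLk⟩ : ∃ k, Complex.exp k = 1 ∧ ∀ z ∈ X ∩ Y, L z = L' z + k := by
    rcases (X ∩ Y).eq_empty_or_nonempty with he | ⟨c, hc⟩
    · exact ⟨0, Complex.exp_zero, by simp [he]⟩
    · refine ⟨L c - L' c, hone c hc, fun z hz ↦ ?_⟩
      have : L z - L' z = L c - L' c := eq_of_exp_eq_one hXY
        ((hL.mono inter_subset_left).sub (hL'.mono inter_subset_right)) hone hz hc
      rw [← this]
      ring
  have e1 : EqOn (X.piecewise L fun z ↦ L' z + k) L X := piecewise_eqOn _ _ _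
  have e2 : EqOn (X.piecewise L fun z ↦ L' z + k) (fun z ↦ L' z + k) Y := by
    intro z hz
    by_cases hzX : z ∈ X
    · rw [piecewise_eq_of_mem _ _ _ hzX]
      exact hLk z ⟨hzX, hz⟩
    · exact piecewise_eq_of_notMem _ _ _ hzX
  refine ⟨X.piecewise L fun z ↦ L' z + k, ContinuousOn.union_of_isClosed (hL.congr e1)
    ((hL'.add continuousOn_const).congr e2) hX hY, ?_⟩
  rintro z (hz | hz)
  · rw [e1 hz, hexp z hz]
  · rw [e2 hz, Complex.exp_add, hk, mul_one, hexp' z hz]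

/-- There is no continuous logarithm of `z - p` on a circle around `p`. -/
theorem not_continuous_log_on_sphere {p : ℂ} {R : ℝ} (hR : 0 < R) {G : ℂ → ℂ}
    (hG : Continuous G) (h : ∀ z ∈ sphere p R, Complex.exp (G z) = z - p) : False := by
  set u : ℝ → ℂ := fun t ↦ G (p + R * Complex.exp (t * Complex.I)) - t * Complex.I -
    Real.log R with hu
  have huc : Continuous u := by fun_prop
  have hexp : ∀ t ∈ (univ : Set ℝ), Complex.exp (u t) = 1 := by
    intro t _
    rw [hu, Complex.exp_sub, Complex.exp_sub, h, ← Complex.ofReal_exp, Real.exp_log hR]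
    · have h1 : (R : ℂ) ≠ 0 := by exact_mod_cast hR.ne'
      have h2 := Complex.exp_ne_zero (t * Complex.I)
      field_simp
      ring
    · rw [mem_sphere, dist_eq_norm, add_sub_cancel_left, norm_mul, Complex.norm_exp_ofReal_mul_I,
        mul_one, Complex.norm_real, Real.norm_of_nonneg hR.le]
  have := eq_of_exp_eq_one isPreconnected_univ huc.continuousOn hexp
    (mem_univ 0) (mem_univ (2 * Real.pi))
  simp only [hu] at this
  push_cast at this
  rw [Complex.exp_two_pi_mul_I, zero_mul, Complex.exp_zero] at this
  have h3 : (2 : ℂ) * Real.pi * Complex.I = 0 := by linear_combination this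
  exact Complex.two_pi_I_ne_zero h3

theorem closure_connectedComponentIn_subset {X : Set ℂ} (hX : IsClosed X) (p : ℂ) :
    closure (connectedComponentIn Xᶜ p) ⊆ connectedComponentIn Xᶜ p ∪ X := by
  intro z hz
  by_cases hzX : z ∈ X
  · exact Or.inr hzX
  · left
    obtain ⟨y, hyz, hyp⟩ := mem_closure_iff.1 hz _ (hX.isOpen_compl.connectedComponentIn (x := z))
      (mem_connectedComponentIn hzX)
    rw [connectedComponentIn_eq hyp, ← connectedComponentIn_eq hyz]
    exact mem_connectedComponentIn hzX

theorem HasQuotientLog.mem_of_isBounded {X : Set ℂ} (hX : IsClosed X) {p q : ℂ} (hp : p ∉ X)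
    (hq : q ∉ X) (h : HasQuotientLog X p q)
    (hb : Bornology.IsBounded (connectedComponentIn Xᶜ p)) : q ∈ connectedComponentIn Xᶜ p := by
  classical
  by_contra hqU
  obtain ⟨L, hL, hexp⟩ := h
  set U := connectedComponentIn Xᶜ p with hU
  have hUo : IsOpen U := hX.isOpen_compl.connectedComponentIn
  have hpU : p ∈ U := mem_connectedComponentIn hp
  obtain ⟨g, hg⟩ := ContinuousMap.exists_restrict_eq hX ⟨X.domRestrict L, hL.domRestrict⟩
  have hgX : ∀ z ∈ X, g z = L z := fun z hz ↦ DFunLike.congr_fun hg ⟨z, hz⟩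
  set F : ℂ → ℂ := fun z ↦ if z ∈ U then Complex.exp (g z) * (z - q) else z - p with hF
  have hFc : Continuous F := by
    refine Continuous.if ?_ (by fun_prop) (by fun_prop)
    intro a ha
    have haX : a ∈ X := by
      rw [ofPred_mem_eq, hUo.frontier_eq] at ha
      exact (closure_connectedComponentIn_subset hX p ha.1).resolve_left ha.2
    have : a - q ≠ 0 := sub_ne_zero.2 fun h ↦ hq (h ▸ haX)
    rw [hgX a haX, hexp a haX, div_mul_cancel₀ _ this]
  have hF0 : ∀ z, F z ≠ 0 := by
    intro z
    by_cases hz : z ∈ U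
    · simp only [hF, if_pos hz]
      exact mul_ne_zero (Complex.exp_ne_zero _) (sub_ne_zero.2 fun h ↦ hqU (h ▸ hz))
    · simp only [hF, if_neg hz]
      exact sub_ne_zero.2 fun h ↦ hz (h ▸ hpU)
  have hsc : IsSimplyConnected (univ : Set ℂ) := by
    have := convex_univ (𝕜 := ℝ) (E := ℂ) |>.contractibleSpace univ_nonempty
    exact (inferInstance : SimplyConnectedSpace (univ : Set ℂ))
  obtain ⟨G, hG, hGF⟩ := Complex.exists_continuousOn_eqOn_exp_comp hsc isOpen_univ
    hFc.continuousOn (by rintro ⟨z, -, hz⟩; exact hF0 z hz)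
  obtain ⟨R, hR, hRU⟩ := hb.subset_ball_lt 0 p
  refine not_continuous_log_on_sphere (p := p) hR (continuousOn_univ.1 hG) fun z hz ↦ ?_
  have hzU : z ∉ U := fun h ↦ by
    have := hRU h
    rw [mem_ball, mem_sphere.1 hz] at this
    exact lt_irrefl _ this
  have := hGF (mem_univ z)
  simpa only [Function.comp_apply, hF, if_neg hzU] using this

theorem isPreconnected_compl_closedBall (c : ℂ) {R : ℝ} (hR : 0 < R) :
    IsPreconnected (closedBall c R)ᶜ := by
  have hconv : Convex ℝ {z : ℂ | Real.log R < z.re} := convex_halfSpace_re_gt _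
  have : (closedBall c R)ᶜ = (fun z ↦ c + Complex.exp z) '' {z : ℂ | Real.log R < z.re} := by
    ext z
    rw [mem_compl_iff, mem_closedBall, not_le, dist_eq_norm]
    constructor
    · intro hz
      have h0 : z - c ≠ 0 := norm_pos_iff.1 (hR.trans hz)
      refine ⟨Complex.log (z - c), ?_, ?_⟩
      · rw [mem_ofPred_eq, Complex.log_re]
        exact Real.log_lt_log hR hz
      · simp only [Complex.exp_log h0]
        ring
    · rintro ⟨y, hy, rfl⟩
      rw [add_sub_cancel_left, Complex.norm_exp]
      exact (Real.log_lt_iff_lt_exp hR).1 hy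
  rw [this]
  exact hconv.isPreconnected.image _ (by fun_prop)

theorem HasQuotientLog.mem_connectedComponentIn {X : Set ℂ} (hX : IsCompact X) {p q : ℂ}
    (hp : p ∉ X) (hq : q ∉ X) (h : HasQuotientLog X p q) : q ∈ connectedComponentIn Xᶜ p := by
  by_cases hb : Bornology.IsBounded (connectedComponentIn Xᶜ p)
  · exact h.mem_of_isBounded hX.isClosed hp hq hb
  by_cases hb' : Bornology.IsBounded (connectedComponentIn Xᶜ q)
  · rw [← connectedComponentIn_eq (h.symm.mem_of_isBounded hX.isClosed hq hp hb')]
    exact _root_.mem_connectedComponentIn hq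
  obtain ⟨R, hR, hRX⟩ := hX.isBounded.subset_closedBall_lt 0 0
  have hext : ∀ x, ¬ Bornology.IsBounded (connectedComponentIn Xᶜ x) →
      (closedBall 0 R)ᶜ ⊆ connectedComponentIn Xᶜ x := by
    intro x hx
    obtain ⟨y, hy, hyR⟩ := not_subset.1 fun h ↦ hx (isBounded_closedBall.subset h)
    rw [connectedComponentIn_eq hy]
    exact (isPreconnected_compl_closedBall 0 hR).subset_connectedComponentIn hyR
      (compl_subset_compl.2 hRX)
  obtain ⟨y, hy, hyR⟩ := not_subset.1 fun h ↦ hb (isBounded_closedBall.subset h)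
  rw [connectedComponentIn_eq hy, ← connectedComponentIn_eq (hext q hb' hyR)]
  exact _root_.mem_connectedComponentIn hq

/-- A consequence of Janiszewski's theorem: a small compact set meeting the boundary of `W` in a
connected set separates `W` only nearby. -/
theorem mem_connectedComponentIn_diff {W K : Set ℂ} (hWb : Bornology.IsBounded W) (hW : IsOpen W)
    (hWc : IsPreconnected W) (hK : IsCompact K) (hKW : IsPreconnected (frontier W ∩ K)) {c : ℂ}
    {ρ : ℝ} (hρ : 0 < ρ) (hKρ : K ⊆ closedBall c ρ) {w z : ℂ} (hw : w ∈ W) (hz : z ∈ W)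
    (hwρ : w ∉ closedBall c ρ) (hzρ : z ∉ closedBall c ρ) :
    z ∈ connectedComponentIn (W \ K) w := by
  have hfr : ∀ x ∈ W, x ∉ frontier W := fun x hx h ↦ by
    rw [hW.frontier_eq] at h
    exact h.2 hx
  have hfc : IsCompact (frontier W) :=
    hWb.isCompact_closure.of_isClosed_subset isClosed_frontier frontier_subset_closure
  have h1 : HasQuotientLog (frontier W) w z := hasQuotientLog_of_isPreconnected
    isClosed_frontier hWc (disjoint_left.2 hfr) hw hz
  have h2 : HasQuotientLog K w z := hasQuotientLog_of_isPreconnected hK.isClosed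
    (isPreconnected_compl_closedBall c hρ) (disjoint_compl_left_iff_subset.2 hKρ) hwρ hzρ
  have h3 := (h1.union isClosed_frontier hK.isClosed hKW (hfr w hw) (hfr z hz)
    h2).mem_connectedComponentIn (hfc.union hK)
    (by rintro (h | h); exacts [hfr w hw h, hwρ (hKρ h)])
    (by rintro (h | h); exacts [hfr z hz h, hzρ (hKρ h)])
  set C := connectedComponentIn (frontier W ∪ K)ᶜ w with hC
  have hCsub : C ⊆ (frontier W ∪ K)ᶜ := connectedComponentIn_subset _ _
  have hwC : w ∈ C := _root_.mem_connectedComponentIn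
    (by rintro (h | h); exacts [hfr w hw h, hwρ (hKρ h)])
  have hCW : C ⊆ W := by
    refine isPreconnected_connectedComponentIn.subset_left_of_subset_union (v := (closure W)ᶜ) hW
      isClosed_closure.isOpen_compl
      (disjoint_compl_right_iff_subset.2 subset_closure) (fun x hx ↦ ?_) ⟨w, hwC, hw⟩
    by_cases hxW : x ∈ W
    · exact Or.inl hxW
    · exact Or.inr fun hxc ↦ hCsub hx (Or.inl (by rw [hW.frontier_eq]; exact ⟨hxc, hxW⟩))
  have hCWK : C ⊆ W \ K := fun x hx ↦ ⟨hCW hx, fun hxK ↦ hCsub hx (Or.inr hxK)⟩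
  exact isPreconnected_connectedComponentIn.subset_connectedComponentIn hwC hCWK h3

theorem exists_small_continuum {F : Set ℂ} (hF : IsCompact F) (hlc : LocallyConnectedSpace F)
    {ε : ℝ} (hε : 0 < ε) : ∃ δ > 0, ∀ a ∈ F, ∀ b ∈ F, dist a b < δ →
      ∃ A ⊆ F, IsCompact A ∧ IsPreconnected A ∧ a ∈ A ∧ b ∈ A ∧ A ⊆ closedBall a ε := by
  have : CompactSpace F := isCompact_iff_compactSpace.1 hF
  have hV (x : F) : ∃ V ⊆ ball x (ε / 2), IsOpen V ∧ x ∈ V ∧ IsConnected V :=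
    locallyConnectedSpace_iff_subsets_isOpen_isConnected.1 hlc x _ (ball_mem_nhds x (half_pos hε))
  choose V hVb hVo hxV hVc using hV
  obtain ⟨δ, hδ, h⟩ := lebesgue_number_lemma_of_metric (isCompact_univ (X := F)) hVo
    (fun x _ ↦ mem_iUnion.2 ⟨x, hxV x⟩)
  refine ⟨δ, hδ, fun a ha b hb hab ↦ ?_⟩
  obtain ⟨x, hx⟩ := h ⟨a, ha⟩ (mem_univ _)
  have hcl : closure (V x) ⊆ closedBall x (ε / 2) :=
    closure_minimal ((hVb x).trans ball_subset_closedBall) isClosed_closedBall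
  have haV : (⟨a, ha⟩ : F) ∈ closure (V x) := subset_closure (hx (mem_ball_self hδ))
  have hbV : (⟨b, hb⟩ : F) ∈ closure (V x) :=
    subset_closure (hx (by rw [mem_ball, dist_comm]; exact hab))
  refine ⟨Subtype.val '' closure (V x), by rintro _ ⟨y, -, rfl⟩; exact y.2,
    isClosed_closure.isCompact.image continuous_subtype_val,
    (hVc x).isPreconnected.closure.image _ continuous_subtype_val.continuousOn,
    ⟨_, haV, rfl⟩, ⟨_, hbV, rfl⟩, ?_⟩
  rintro _ ⟨y, hy, rfl⟩
  have h1 := hcl hy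
  have h2 := hcl haV
  rw [mem_closedBall] at h1 h2 ⊢
  have h3 := dist_triangle_right y ⟨a, ha⟩ x
  change dist y ⟨a, ha⟩ ≤ ε
  linarith

theorem crosscutNbhd_subset_closedBall {W A : Set ℂ} {γ : ℝ → ℂ} (hWb : Bornology.IsBounded W)
    (hW : IsOpen W) (hWc : IsPreconnected W) (hγ : IsCrosscut W γ) (hA : IsCompact A)
    (hAc : IsPreconnected A) (hAW : A ⊆ frontier W) (h0 : γ 0 ∈ A) (h1 : γ 1 ∈ A) {c : ℂ} {ρ : ℝ}
    (hρ : 0 < ρ) (hγρ : γ '' Icc 0 1 ⊆ closedBall c ρ) (hAρ : A ⊆ closedBall c ρ) {w : ℂ}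
    (hw : w ∈ W) (hwρ : w ∉ closedBall c ρ) : crosscutNbhd W w γ ⊆ closedBall c ρ := by
  intro z hz
  by_contra hzρ
  have hfr : frontier W ∩ (γ '' Icc 0 1 ∪ A) = A := by
    ext x
    refine ⟨?_, fun hx ↦ ⟨hAW hx, Or.inr hx⟩⟩
    rintro ⟨hx, ⟨t, ht, rfl⟩ | hxA⟩
    · rcases eq_endpoints_or_mem_Ioo_of_mem_Icc ht with rfl | rfl | ht
      · exact h0
      · exact h1
      · rw [hW.frontier_eq] at hx
        exact absurd (hγ.2.2.1 t ht) hx.2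
    · exact hxA
  have hmem := mem_connectedComponentIn_diff hWb hW hWc
    ((isCompact_Icc.image_of_continuousOn hγ.1).union hA) (hfr.symm ▸ hAc) hρ
    (union_subset hγρ hAρ) hw hz.1.1 hwρ hzρ
  have hmem' : z ∈ connectedComponentIn (W \ γ '' Ioo 0 1) w :=
    connectedComponentIn_mono w (sdiff_subset_sdiff_right
      ((image_mono Ioo_subset_Icc_self).trans subset_union_left)) hmem
  refine hz.2 ?_
  rw [← connectedComponentIn_eq hmem']
  refine mem_connectedComponentIn ⟨hw, fun h ↦ hwρ (hγρ (image_mono Ioo_subset_Icc_self h))⟩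

theorem exists_caratheodoryModulus {W : Set ℂ} (hWb : Bornology.IsBounded W)
    (hW : IsOpen W) (hWc : IsPreconnected W) {w : ℂ} (hw : w ∈ W)
    (hlc : LocallyConnectedSpace (frontier W)) :
    ∃ a > 0, ∃ η : ℝ → ℝ, IsCaratheodoryModulus W w a η ∧ Tendsto η (𝓝[>] 0) (𝓝 0) := by
  have hfc : IsCompact (frontier W) :=
    hWb.isCompact_closure.of_isClosed_subset isClosed_frontier frontier_subset_closure
  let S : ℝ → Set ℝ := fun r ↦ insert 0 {d | ∃ γ, IsCrosscut W γ ∧ w ∉ γ '' Ioo 0 1 ∧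
    diam (γ '' Icc 0 1) < r ∧ d = diam (crosscutNbhd W w γ)}
  have hSb (r : ℝ) : BddAbove (S r) := by
    refine ⟨diam W, ?_⟩
    rintro _ (rfl | ⟨γ, -, -, -, rfl⟩)
    · exact diam_nonneg
    · exact diam_mono (fun z hz ↦ hz.1.1) hWb
  have hSmono {r s : ℝ} (h : r ≤ s) : sSup (S r) ≤ sSup (S s) := by
    refine csSup_le_csSup (hSb s) ⟨0, mem_insert _ _⟩ (insert_subset_insert ?_)
    rintro _ ⟨γ, h1, h2, h3, h4⟩
    exact ⟨γ, h1, h2, h3.trans_le h, h4⟩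
  have hS0 (r : ℝ) : 0 ≤ sSup (S r) := le_csSup (hSb r) (mem_insert _ _)
  refine ⟨1, one_pos, fun r ↦ r + sSup (S r), ⟨fun r _ s _ hrs ↦ add_lt_add_of_lt_of_le hrs
    (hSmono hrs.le), fun γ hγ hwγ r hr _ ↦ ?_⟩, ?_⟩
  · have h1 : 0 < r := diam_nonneg.trans_lt hr
    have h2 : diam (crosscutNbhd W w γ) ≤ sSup (S r) :=
      le_csSup (hSb r) (Or.inr ⟨γ, hγ, hwγ, hr, rfl⟩)
    change _ < r + sSup (S r)
    linarith
  · obtain ⟨d, hd, hdW⟩ := Metric.isOpen_iff.1 hW w hw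
    rw [Metric.tendsto_nhdsWithin_nhds]
    intro ε hε
    obtain ⟨ρ, hρ, hρd, hρε⟩ : ∃ ρ > 0, ρ < d ∧ ρ < ε / 4 :=
      ⟨min d (ε / 4) / 2, by positivity,
        (half_lt_self (by positivity)).trans_le (min_le_left _ _),
        (half_lt_self (by positivity)).trans_le (min_le_right _ _)⟩
    obtain ⟨δ, hδ, h⟩ := exists_small_continuum hfc hlc hρ
    refine ⟨min δ ρ, lt_min hδ hρ, fun r hr hrd ↦ ?_⟩
    have hr0 : 0 < r := hr
    rw [Real.dist_eq, sub_zero, abs_of_pos hr0] at hrd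
    rw [Real.dist_eq, sub_zero, abs_of_nonneg (add_nonneg hr0.le (hS0 r))]
    have hle : sSup (S r) ≤ 2 * ρ := by
      refine csSup_le ⟨0, mem_insert _ _⟩ ?_
      rintro _ (rfl | ⟨γ, hγ, hwγ, hγr, rfl⟩)
      · positivity
      have hγb : Bornology.IsBounded (γ '' Icc 0 1) :=
        (isCompact_Icc.image_of_continuousOn hγ.1).isBounded
      have hdist (t : ℝ) (ht : t ∈ Icc (0 : ℝ) 1) : dist (γ t) (γ 0) < r :=
        (dist_le_diam_of_mem hγb (mem_image_of_mem γ ht)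
          (mem_image_of_mem γ (by simp))).trans_lt hγr
      obtain ⟨A, hAW, hA, hAc, h0, h1, hAρ⟩ := h (γ 0) hγ.2.2.2.1 (γ 1) hγ.2.2.2.2 (by
        rw [dist_comm]
        exact (hdist 1 (by simp)).trans (hrd.trans_le (min_le_left _ _)))
      have hsub : crosscutNbhd W w γ ⊆ closedBall (γ 0) ρ := by
        refine crosscutNbhd_subset_closedBall hWb hW hWc hγ hA hAc hAW h0 h1 hρ ?_ hAρ hw ?_
        · rintro _ ⟨t, ht, rfl⟩
          exact ((hdist t ht).trans (hrd.trans_le (min_le_right _ _))).le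
        · intro hwc
          rw [mem_closedBall, dist_comm] at hwc
          have hmem : γ 0 ∈ W := hdW (mem_ball.2 (hwc.trans_lt hρd))
          have := hγ.2.2.2.1
          rw [hW.frontier_eq] at this
          exact this.2 hmem
      exact (diam_mono hsub isBounded_closedBall).trans (diam_closedBall hρ.le)
    have := hrd.trans_le (min_le_right _ _)
    linarith

theorem lintegral_enorm_deriv_sq {U : Set ℂ} {h : ℂ → ℂ} (hU : IsOpen U)
    (hh : DifferentiableOn ℂ h U) (hinj : InjOn h U) :
    ∫⁻ z in U, ‖deriv h z‖ₑ ^ 2 = volume (h '' U) := by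
  rw [← lintegral_abs_det_fderiv_eq_addHaar_image volume hU.measurableSet
    (f' := fun z ↦ ((ContinuousLinearMap.toSpanSingleton ℂ (deriv h z)).restrictScalars ℝ))
    (fun z hz ↦ ?_) hinj]
  · refine lintegral_congr fun z ↦ ?_
    have hdet : ((ContinuousLinearMap.toSpanSingleton ℂ (deriv h z)).restrictScalars ℝ).det =
        Algebra.norm ℝ (deriv h z) := by
      rw [Algebra.norm_apply]
      refine congrArg LinearMap.det (LinearMap.ext fun x ↦ ?_)
      simp [mul_comm]
    rw [hdet, Algebra.norm_complex_apply, Complex.normSq_eq_norm_sq, abs_of_nonneg (by positivity),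
      ENNReal.ofReal_pow (norm_nonneg _), ofReal_norm]
  · exact ((hh.differentiableAt (hU.mem_nhds hz)).hasDerivAt.hasFDerivAt.restrictScalars
      ℝ).hasFDerivWithinAt

theorem sq_lintegral_Ioo_le {b : ℝ} {f : ℝ → ENNReal} (hf : Measurable f) :
    (∫⁻ t in Ioo 0 b, f t) ^ 2 ≤ ENNReal.ofReal b * ∫⁻ t in Ioo 0 b, f t ^ 2 := by
  have h := ENNReal.lintegral_mul_le_Lp_mul_Lq (volume.restrict (Ioo 0 b))
    Real.HolderConjugate.two_two (f := fun _ ↦ 1) (g := f) aemeasurable_const hf.aemeasurable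
  have h2 := pow_le_pow_left' h 2
  simp only [Pi.mul_apply, one_mul, ENNReal.one_rpow, lintegral_one, Measure.restrict_apply_univ,
    Real.volume_Ioo, sub_zero, mul_pow] at h2
  refine h2.trans (le_of_eq ?_)
  simp only [← ENNReal.rpow_natCast, ← ENNReal.rpow_mul]
  norm_num

theorem exists_lintegral_enorm_deriv_sq_le {U : Set ℂ} {h : ℂ → ℂ} {T : ℝ} (hT : 0 < T)
    (hU : IsOpen U) (hh : DifferentiableOn ℂ h U) (hinj : InjOn h U)
    (hsub : Ioo (-(2 * T)) (-T) ×ℂ Ioo 0 Real.pi ⊆ U) :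
    ∃ s ∈ Ioo (-(2 * T)) (-T), (∫⁻ t in Ioo 0 Real.pi, ‖deriv h (s + t * Complex.I)‖ₑ) ^ 2 ≤
      ENNReal.ofReal Real.pi * volume (h '' U) / ENNReal.ofReal T := by
  set I := Ioo (-(2 * T)) (-T) with hI
  have hvI : volume I = ENNReal.ofReal T := by
    rw [hI, Real.volume_Ioo]; ring_nf
  have hmeas : Measurable fun p : ℝ × ℝ ↦ ‖deriv h (p.1 + p.2 * Complex.I)‖ₑ :=
    ((measurable_deriv h).comp (by fun_prop)).enorm
  have h1 : ∫⁻ s in I, ∫⁻ t in Ioo 0 Real.pi, ‖deriv h (s + t * Complex.I)‖ₑ ^ 2 ≤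
      volume (h '' U) := by
    rw [← lintegral_enorm_deriv_sq hU hh hinj]
    refine le_trans (le_of_eq ?_) (lintegral_mono_set hsub)
    have h2 := Complex.volume_preserving_equiv_real_prod.symm.setLIntegral_comp_preimage_emb
      Complex.measurableEquivRealProd.symm.measurableEmbedding (fun z ↦ ‖deriv h z‖ₑ ^ 2)
      (I ×ℂ Ioo 0 Real.pi)
    rw [← h2, Measure.volume_eq_prod]
    have h3 : (Complex.measurableEquivRealProd.symm ⁻¹' (I ×ℂ Ioo 0 Real.pi)) =
        I ×ˢ Ioo 0 Real.pi := by
      ext ⟨x, y⟩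
      simp [Complex.mem_reProdIm, Complex.measurableEquivRealProd]
    rw [h3, setLIntegral_prod]
    · refine lintegral_congr fun s ↦ lintegral_congr fun t ↦ ?_
      congr 3
      rw [Complex.measurableEquivRealProd_symm_apply, Complex.mk_eq_add_mul_I]
    · exact (((measurable_deriv h).comp
        Complex.measurableEquivRealProd.symm.measurable).enorm.pow_const 2).aemeasurable
  have h4 : ∫⁻ s in I, (∫⁻ t in Ioo 0 Real.pi, ‖deriv h (s + t * Complex.I)‖ₑ) ^ 2 ≤
      ENNReal.ofReal Real.pi * volume (h '' U) := by
    refine le_trans (lintegral_mono fun s ↦ sq_lintegral_Ioo_le ?_) ?_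
    · exact hmeas.comp (measurable_const.prodMk measurable_id)
    · rw [lintegral_const_mul' _ _ ENNReal.ofReal_ne_top]
      gcongr
  obtain ⟨s, hs, h5⟩ := exists_le_setLAverage (μ := volume) (s := I)
    (f := fun s ↦ (∫⁻ t in Ioo 0 Real.pi, ‖deriv h (s + t * Complex.I)‖ₑ) ^ 2)
    (by rw [hvI]; simpa using hT) (by rw [hvI]; simp)
    ((hmeas.lintegral_prod_right' (ν := volume.restrict (Ioo 0 Real.pi))).pow_const 2).aemeasurable
  refine ⟨s, hs, h5.trans ?_⟩
  rw [setLAverage_eq, hvI]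
  gcongr

theorem exists_continuousOn_Icc_extension {b ρ : ℝ} (hb : 0 < b) (hρ : 0 ≤ ρ) {p p' : ℝ → ℂ}
    (hp : ∀ t ∈ Ioo 0 b, HasDerivAt p (p' t) t) (hm : Measurable p')
    (hL : ∫⁻ t in Ioo 0 b, ‖p' t‖ₑ ≤ ENNReal.ofReal ρ) :
    ∃ P : ℝ → ℂ, ContinuousOn P (Icc 0 b) ∧ EqOn P p (Ioo 0 b) ∧
      ∀ s ∈ Icc 0 b, ∀ t ∈ Icc 0 b, dist (P s) (P t) ≤ ρ := by
  have hp_int : IntegrableOn p' (Ioo 0 b) :=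
    ⟨hm.aestronglyMeasurable, hL.trans_lt ENNReal.ofReal_lt_top⟩
  have hp_int' : IntegrableOn p' (Icc 0 b) := (integrableOn_Icc_iff_integrableOn_Ioo).2 hp_int
  have hii (s t : ℝ) (hs : s ∈ Icc 0 b) (ht : t ∈ Icc 0 b) : IntervalIntegrable p' volume s t :=
    (hp_int'.mono_set (uIcc_subset_Icc hs ht)).intervalIntegrable
  have hnorm : ∫ t in Ioo 0 b, ‖p' t‖ ≤ ρ := by
    rw [integral_norm_eq_lintegral_enorm hm.aestronglyMeasurable]
    exact ENNReal.toReal_le_of_le_ofReal hρ hL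
  have hmid : b / 2 ∈ Ioo 0 b := ⟨by linarith, by linarith⟩
  have hmid' := Ioo_subset_Icc_self hmid
  refine ⟨fun t ↦ p (b / 2) + ∫ u in (b / 2)..t, p' u, ?_, fun t ht ↦ ?_, fun s hs t ht ↦ ?_⟩
  · have := intervalIntegral.continuousOn_primitive_interval'
      (hii 0 b (left_mem_Icc.2 hb.le) (right_mem_Icc.2 hb.le)) (a := b / 2)
      (by rwa [uIcc_of_le hb.le])
    rw [uIcc_of_le hb.le] at this
    exact continuousOn_const.add this
  · change p (b / 2) + ∫ u in (b / 2)..t, p' u = p t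
    rw [intervalIntegral.integral_eq_sub_of_hasDerivAt (f := p) (fun x hx ↦ hp x ?_)
      (hii _ _ hmid' (Ioo_subset_Icc_self ht))]
    · ring
    · exact ordConnected_Ioo.uIcc_subset hmid ht hx
  · rw [dist_add_left, dist_eq_norm, intervalIntegral.integral_interval_sub_left
      (hii _ _ hmid' hs) (hii _ _ hmid' ht)]
    refine (intervalIntegral.norm_integral_le_integral_norm_uIoc).trans (le_trans ?_ hnorm)
    rw [← integral_Icc_eq_integral_Ioo]
    exact setIntegral_mono_set hp_int'.norm (Eventually.of_forall fun _ ↦ norm_nonneg _)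
      (uIoc_subset_uIcc.trans (uIcc_subset_Icc ht hs)).eventuallyLE

theorem notMem_of_tendsto {S W : Set ℂ} {h k : ℂ → ℂ} (hW : IsOpen W) (hk : ContinuousOn k W)
    (hkW : MapsTo k W S) (hkh : ∀ z ∈ S, k (h z) = z) {ι : Type*} {l : Filter ι} [l.NeBot]
    {u : ι → ℂ} (hu : ∀ᶠ i in l, u i ∈ S) {z : ℂ} (hz : Tendsto u l (𝓝 z)) (hzS : z ∉ S) {y : ℂ}
    (hy : Tendsto (fun i ↦ h (u i)) l (𝓝 y)) : y ∉ W := by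
  intro hyW
  have h1 : Tendsto (fun i ↦ k (h (u i))) l (𝓝 (k y)) :=
    (hk.continuousAt (hW.mem_nhds hyW)).tendsto.comp hy
  have h2 : Tendsto u l (𝓝 (k y)) := h1.congr' (hu.mono fun i hi ↦ hkh _ hi)
  exact hzS (tendsto_nhds_unique hz h2 ▸ hkW hyW)

/-- The open horizontal strip of points with imaginary part between `0` and `π`. -/
def horizontalStrip : Set ℂ := {z | z.im ∈ Ioo 0 Real.pi}

theorem isOpen_horizontalStrip : IsOpen horizontalStrip :=
  isOpen_Ioo.preimage Complex.continuous_im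

theorem notMem_connectedComponentIn_diff {S W Γ : Set ℂ} {h k : ℂ → ℂ} (hW : IsOpen W)
    (hk : ContinuousOn k W) (hkW : MapsTo k W S) (hhk : ∀ x ∈ W, h (k x) = x)
    (hkh : ∀ z ∈ S, k (h z) = z) {s : ℝ} (hΓ : ∀ z ∈ S, z.re = s → h z ∈ Γ) {u z₀ : ℂ}
    (hu : u ∈ S) (hus : u.re < s) (hz₀ : z₀ ∈ S) (hsz₀ : s < z₀.re) :
    h z₀ ∉ connectedComponentIn (W \ Γ) (h u) := by
  intro hmem
  set C := connectedComponentIn (W \ Γ) (h u) with hC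
  have hCW : C ⊆ W \ Γ := connectedComponentIn_subset _ _
  have hre (z : ℂ) (hz : h z ∈ C) (hzS : z ∈ S) : z.re ≠ s := fun h' ↦ (hCW hz).2 (hΓ z hzS h')
  have huC : h u ∈ C := by
    by_contra huC
    have : h u ∉ W \ Γ := fun h' ↦ huC (mem_connectedComponentIn h')
    rw [hC, connectedComponentIn_eq_empty this] at hmem
    exact hmem
  have hA : IsOpen (W ∩ k ⁻¹' {z | z.re < s}) :=
    hk.isOpen_inter_preimage hW (isOpen_Iio.preimage Complex.continuous_re)
  have hB : IsOpen (W ∩ k ⁻¹' {z | s < z.re}) :=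
    hk.isOpen_inter_preimage hW (isOpen_Ioi.preimage Complex.continuous_re)
  have hCA := isPreconnected_connectedComponentIn.subset_left_of_subset_union hA hB
    (disjoint_left.2 fun x hx hx' ↦ lt_asymm (show (k x).re < s from hx.2) hx'.2)
    (fun x (hx : x ∈ C) ↦ by
      have hxW := (hCW hx).1
      rcases lt_or_gt_of_ne (hre (k x) (by rwa [hhk x hxW]) (hkW hxW)) with h' | h'
      · exact Or.inl ⟨hxW, h'⟩
      · exact Or.inr ⟨hxW, h'⟩)
    ⟨h u, huC, (hCW huC).1, by
      change (k (h u)).re < s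
      rwa [hkh u hu]⟩
  have h1 : (k (h z₀)).re < s := (hCA hmem).2
  rw [hkh z₀ hz₀] at h1
  exact lt_asymm h1 hsz₀

theorem dist_le_of_crossing {W : Set ℂ} {h k : ℂ → ℂ} (hWb : Bornology.IsBounded W)
    (hW : IsOpen W) (hWc : IsPreconnected W) (hk : ContinuousOn k W)
    (hkW : MapsTo k W horizontalStrip) (hhW : MapsTo h horizontalStrip W)
    (hhk : ∀ x ∈ W, h (k x) = x) (hkh : ∀ z ∈ horizontalStrip, k (h z) = z) {z₀ : ℂ}
    (hz₀ : z₀ ∈ horizontalStrip) {a r ρ ε s : ℝ} {η : ℝ → ℝ}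
    (hη : IsCaratheodoryModulus W (h z₀) a η) (hra : r < a) (hηr : η r ≤ ε) (hρ : 0 < ρ)
    (hρr : ρ < r) (hρε : 2 * ρ ≤ ε) (hρw : ∀ c ∈ frontier W, h z₀ ∉ closedBall c ρ)
    (hs : s < z₀.re) {P : ℝ → ℂ} (hPc : ContinuousOn P (Icc 0 Real.pi))
    (hPh : EqOn P (fun t ↦ h (s + t * Complex.I)) (Ioo 0 Real.pi))
    (hPd : ∀ t ∈ Icc 0 Real.pi, ∀ t' ∈ Icc 0 Real.pi, dist (P t) (P t') ≤ ρ) {u v : ℂ}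
    (hu : u ∈ horizontalStrip) (hv : v ∈ horizontalStrip) (hus : u.re < s) (hvs : v.re < s) :
    dist (h u) (h v) ≤ ε := by
  have hpi := Real.pi_pos
  have hline (t : ℝ) (ht : t ∈ Ioo 0 Real.pi) : (s + t * Complex.I : ℂ) ∈ horizontalStrip := by
    simpa [horizontalStrip] using ht
  have hPW (t : ℝ) (ht : t ∈ Ioo 0 Real.pi) : P t ∈ W := by
    rw [hPh ht]; exact hhW (hline t ht)
  have hfr (x : ℂ) (hx : x ∈ frontier W) : x ∉ W := by
    rw [hW.frontier_eq] at hx; exact hx.2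
  have hend (t₀ : ℝ) (ht₀ : t₀ ∈ Icc 0 Real.pi) (ht₀' : t₀ ∉ Ioo 0 Real.pi) :
      P t₀ ∈ frontier W := by
    have hcl : t₀ ∈ closure (Ioo 0 Real.pi) := by rwa [closure_Ioo hpi.ne]
    have hne : (𝓝[Ioo 0 Real.pi] t₀).NeBot := mem_closure_iff_nhdsWithin_neBot.1 hcl
    have h1 : Tendsto P (𝓝[Ioo 0 Real.pi] t₀) (𝓝 (P t₀)) :=
      (hPc t₀ ht₀).mono_left (nhdsWithin_mono _ Ioo_subset_Icc_self)
    rw [hW.frontier_eq]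
    refine ⟨mem_closure_of_tendsto h1 (eventually_mem_nhdsWithin.mono hPW), ?_⟩
    refine notMem_of_tendsto (u := fun t : ℝ ↦ (s + t * Complex.I : ℂ)) hW hk hkW hkh
      (eventually_mem_nhdsWithin.mono hline)
      (z := s + t₀ * Complex.I) ?_ ?_
      (h1.congr' (eventually_mem_nhdsWithin.mono fun t ht ↦ hPh ht))
    · have : Continuous fun t : ℝ ↦ (s + t * Complex.I : ℂ) := by fun_prop
      exact this.continuousAt.continuousWithinAt
    · simpa [horizontalStrip] using ht₀'
  have h0 := hend 0 (left_mem_Icc.2 hpi.le) (by simp)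
  have h1 := hend Real.pi (right_mem_Icc.2 hpi.le) (by simp)
  have hΓ (z : ℂ) (hz : z ∈ horizontalStrip) (hzs : z.re = s) : h z ∈ P '' Ioo 0 Real.pi := by
    refine ⟨z.im, hz, ?_⟩
    rw [hPh hz, ← hzs]
    simp
  have hsep {x : ℂ} (hx : x ∈ horizontalStrip) (hxs : x.re < s) :
      h z₀ ∉ connectedComponentIn (W \ P '' Ioo 0 Real.pi) (h x) :=
    notMem_connectedComponentIn_diff hW hk hkW hhk hkh hΓ hx hxs hz₀ hs
  have hnot {x : ℂ} (hx : x ∈ horizontalStrip) (hxs : x.re ≠ s) : h x ∉ P '' Ioo 0 Real.pi := by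
    rintro ⟨t, ht, htx⟩
    rw [hPh ht] at htx
    have := congrArg Complex.re (congrArg k htx)
    simp only [hkh _ (hline t ht), hkh x hx] at this
    simp at this
    exact hxs this.symm
  by_cases heq : P 0 = P Real.pi
  · have hall {x : ℂ} (hx : x ∈ horizontalStrip) (hxs : x.re < s) :
        h x ∈ closedBall (P 0) ρ := by
      by_contra hxρ
      have hK : frontier W ∩ P '' Icc 0 Real.pi = {P 0} := by
        ext y
        constructor
        · rintro ⟨hy, t, ht, rfl⟩
          rcases eq_endpoints_or_mem_Ioo_of_mem_Icc ht with rfl | rfl | ht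
          · rfl
          · exact heq.symm
          · exact absurd (hPW t ht) (hfr _ hy)
        · rintro rfl
          exact ⟨h0, 0, left_mem_Icc.2 hpi.le, rfl⟩
      have hmem := mem_connectedComponentIn_diff hWb hW hWc
        (isCompact_Icc.image_of_continuousOn hPc) (hK ▸ isPreconnected_singleton) hρ
        (by rintro _ ⟨t, ht, rfl⟩; exact hPd t ht 0 (left_mem_Icc.2 hpi.le))
        (hhW hz₀) (hhW hx) (hρw _ h0) hxρ
      have hmem' := connectedComponentIn_mono (h z₀) (sdiff_subset_sdiff_right
        (image_mono (f := P) Ioo_subset_Icc_self)) hmem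
      refine hsep hx hxs ?_
      rw [← connectedComponentIn_eq hmem']
      exact mem_connectedComponentIn ⟨hhW hz₀, hnot hz₀ hs.ne'⟩
    have h2 := dist_triangle_right (h u) (h v) (P 0)
    have h3 := mem_closedBall.1 (hall hu hus)
    have h4 := mem_closedBall.1 (hall hv hvs)
    linarith
  · set γ : ℝ → ℂ := fun t ↦ P (Real.pi * t) with hγ
    have himg : (fun t ↦ Real.pi * t) '' Icc (0 : ℝ) 1 = Icc 0 Real.pi := by
      rw [image_mul_left_Icc hpi.le zero_le_one, mul_zero, mul_one]
    have himg' : (fun t ↦ Real.pi * t) '' Ioo (0 : ℝ) 1 = Ioo 0 Real.pi := by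
      rw [image_mul_left_Ioo hpi, mul_zero, mul_one]
    have hγI : γ '' Icc 0 1 = P '' Icc 0 Real.pi := by rw [← himg, image_image]
    have hγI' : γ '' Ioo 0 1 = P '' Ioo 0 Real.pi := by rw [← himg', image_image]
    have hPinj : InjOn P (Icc 0 Real.pi) := by
      have key {x y : ℝ} (hx : x ∈ Icc 0 Real.pi) (hy : y ∈ Ioo 0 Real.pi) (hxy : P x = P y) :
          x = y := by
        have hx' : x ∈ Ioo 0 Real.pi := by
          by_contra hx'
          exact hfr _ (hend x hx hx') (hxy ▸ hPW y hy)
        rw [hPh hx', hPh hy] at hxy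
        have := congrArg Complex.im (congrArg k hxy)
        simp only [hkh _ (hline x hx'), hkh _ (hline y hy)] at this
        simpa using this
      intro x hx y hy hxy
      by_cases hy' : y ∈ Ioo 0 Real.pi
      · exact key hx hy' hxy
      by_cases hx' : x ∈ Ioo 0 Real.pi
      · exact (key hy hx' hxy.symm).symm
      rcases eq_endpoints_or_mem_Ioo_of_mem_Icc hx with rfl | rfl | hx
      · rcases eq_endpoints_or_mem_Ioo_of_mem_Icc hy with rfl | rfl | hy
        exacts [rfl, absurd hxy heq, absurd hy hy']
      · rcases eq_endpoints_or_mem_Ioo_of_mem_Icc hy with rfl | rfl | hy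
        exacts [absurd hxy.symm heq, rfl, absurd hy hy']
      · exact absurd hx hx'
    have hcross : IsCrosscut W γ := by
      refine ⟨hPc.comp (by fun_prop) (mapsTo_iff_image_subset.2 himg.le), fun x hx y hy hxy ↦ ?_,
        fun t ht ↦ hPW _ (himg'.le (mem_image_of_mem _ ht)), ?_, ?_⟩
      · exact mul_left_cancel₀ hpi.ne' (hPinj (himg.le (mem_image_of_mem _ hx))
          (himg.le (mem_image_of_mem _ hy)) hxy)
      · simpa [hγ] using h0
      · simpa [hγ] using h1
    have hdiam : diam (γ '' Icc 0 1) < r := by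
      refine lt_of_le_of_lt (diam_le_of_forall_dist_le hρ.le ?_) hρr
      rw [hγI]
      rintro _ ⟨t, ht, rfl⟩ _ ⟨t', ht', rfl⟩
      exact hPd t ht t' ht'
    have hN := hη.2 γ hcross (hγI' ▸ hnot hz₀ hs.ne') r hdiam hra
    have hmem {x : ℂ} (hx : x ∈ horizontalStrip) (hxs : x.re < s) :
        h x ∈ crosscutNbhd W (h z₀) γ := by
      rw [crosscutNbhd, hγI']
      exact ⟨⟨hhW hx, hnot hx hxs.ne⟩, hsep hx hxs⟩
    exact (dist_le_diam_of_mem (hWb.subset fun z hz ↦ hz.1.1) (hmem hu hus) (hmem hv hvs)).trans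
      (hN.le.trans hηr)

theorem exists_forall_re_lt_dist_le {W : Set ℂ} {h k : ℂ → ℂ} (hWb : Bornology.IsBounded W)
    (hW : IsOpen W) (hWc : IsPreconnected W) (hh : DifferentiableOn ℂ h horizontalStrip)
    (hk : ContinuousOn k W)
    (hkW : MapsTo k W horizontalStrip) (hhW : MapsTo h horizontalStrip W)
    (hhk : ∀ x ∈ W, h (k x) = x) (hkh : ∀ z ∈ horizontalStrip, k (h z) = z) {z₀ : ℂ}
    (hz₀ : z₀ ∈ horizontalStrip) {a : ℝ} (ha : 0 < a) {η : ℝ → ℝ}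
    (hη : IsCaratheodoryModulus W (h z₀) a η) (hη0 : Tendsto η (𝓝[>] 0) (𝓝 0)) {ε : ℝ}
    (hε : 0 < ε) : ∃ M : ℝ, ∀ u ∈ horizontalStrip, ∀ v ∈ horizontalStrip, u.re < M → v.re < M →
      dist (h u) (h v) ≤ ε := by
  obtain ⟨d, hd, hdW⟩ := Metric.isOpen_iff.1 hW _ (hhW hz₀)
  obtain ⟨r, hηr, hr0, hra⟩ : ∃ r, η r < ε ∧ 0 < r ∧ r < a :=
    ((hη0.eventually (gt_mem_nhds hε)).and (Ioo_mem_nhdsGT ha)).exists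
  obtain ⟨ρ, hρ, hρr, hρd, hρε⟩ : ∃ ρ > 0, ρ < r ∧ ρ < d ∧ 2 * ρ ≤ ε := by
    refine ⟨min (min (r / 2) (d / 2)) (ε / 2), by positivity, ?_, ?_, ?_⟩
    · exact ((min_le_left _ _).trans (min_le_left _ _)).trans_lt (half_lt_self hr0)
    · exact ((min_le_left _ _).trans (min_le_right _ _)).trans_lt (half_lt_self hd)
    · linarith [min_le_right (min (r / 2) (d / 2)) (ε / 2)]
  have hρw (c : ℂ) (hc : c ∈ frontier W) : h z₀ ∉ closedBall c ρ := by
    intro hmem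
    rw [mem_closedBall, dist_comm] at hmem
    rw [hW.frontier_eq] at hc
    exact hc.2 (hdW (mem_ball.2 (hmem.trans_lt hρd)))
  have hVtop : volume W ≠ ⊤ := hWb.measure_lt_top.ne
  obtain ⟨T, hT, hTz, hTV⟩ : ∃ T > 0, -T < z₀.re ∧ Real.pi * (volume W).toReal ≤ T * ρ ^ 2 := by
    refine ⟨max (1 + |z₀.re|) (Real.pi * (volume W).toReal / ρ ^ 2), by positivity, ?_, ?_⟩
    · have h1 := le_max_left (1 + |z₀.re|) (Real.pi * (volume W).toReal / ρ ^ 2)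
      have h2 := neg_abs_le z₀.re
      linarith
    · rw [← div_le_iff₀ (by positivity)]
      exact le_max_right _ _
  have hinj : InjOn h horizontalStrip := fun x hx y hy hxy ↦ by
    rw [← hkh x hx, hxy, hkh y hy]
  have himg : h '' horizontalStrip = W :=
    (mapsTo_iff_image_subset.1 hhW).antisymm fun x hx ↦ ⟨k x, hkW hx, hhk x hx⟩
  obtain ⟨s, hs, hL⟩ := exists_lintegral_enorm_deriv_sq_le hT isOpen_horizontalStrip hh hinj
    (fun z hz ↦ (Complex.mem_reProdIm.1 hz).2)
  have hL' : ∫⁻ t in Ioo 0 Real.pi, ‖deriv h (s + t * Complex.I)‖ₑ ≤ ENNReal.ofReal ρ := by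
    have h1 : ENNReal.ofReal Real.pi * volume (h '' horizontalStrip) / ENNReal.ofReal T ≤
        ENNReal.ofReal ρ ^ 2 := by
      rw [himg, ← ENNReal.ofReal_toReal hVtop, ← ENNReal.ofReal_mul Real.pi_pos.le]
      refine ENNReal.div_le_of_le_mul ?_
      rw [← ENNReal.ofReal_pow hρ.le, ← ENNReal.ofReal_mul (by positivity)]
      exact ENNReal.ofReal_le_ofReal (by linarith)
    exact (ENNReal.pow_le_pow_left_iff two_ne_zero).1 (hL.trans h1)
  have hline (t : ℝ) (ht : t ∈ Ioo 0 Real.pi) : (s + t * Complex.I : ℂ) ∈ horizontalStrip := by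
    simpa [horizontalStrip] using ht
  have hIe : ‖Complex.I‖ₑ = 1 := by rw [← ofReal_norm]; simp
  obtain ⟨P, hPc, hPh, hPd⟩ := exists_continuousOn_Icc_extension Real.pi_pos hρ.le
    (p := fun t : ℝ ↦ h (s + t * Complex.I))
    (p' := fun t : ℝ ↦ deriv h (s + t * Complex.I) * Complex.I) (fun t ht ↦ by
      have h1 : HasDerivAt (fun t : ℝ ↦ (s + t * Complex.I : ℂ)) Complex.I t := by
        simpa using ((Complex.ofRealCLM.hasDerivAt (x := t)).mul_const Complex.I).const_add (s : ℂ)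
      have h2 := (hh.differentiableAt
        (isOpen_horizontalStrip.mem_nhds (hline t ht))).hasDerivAt
      exact h2.comp t h1)
    (((measurable_deriv h).comp (by fun_prop)).mul_const _)
    (by simpa [enorm_mul, hIe] using hL')
  refine ⟨-(2 * T), fun u hu v hv hus hvs ↦ ?_⟩
  exact dist_le_of_crossing hWb hW hWc hk hkW hhW hhk hkh hz₀ hη hra hηr.le hρ hρr hρε hρw
    (hs.2.trans hTz) hPc hPh hPd hu hv (hus.trans hs.1) (hvs.trans hs.1)

theorem Complex.arg_mem_Ioo_of_im_pos {q : ℂ} (hq : 0 < q.im) : q.arg ∈ Ioo 0 Real.pi := by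
  have hq0 : q ≠ 0 := fun h ↦ by simp [h] at hq
  have hsin : 0 < Real.sin q.arg := by
    rw [Complex.sin_arg]
    exact div_pos hq (norm_pos_iff.2 hq0)
  constructor
  · by_contra hle
    exact hsin.not_ge (Real.sin_nonpos_of_nonpos_of_neg_pi_le (not_lt.1 hle)
      (Complex.neg_pi_lt_arg q).le)
  · refine lt_of_le_of_ne (Complex.arg_le_pi q) fun h ↦ ?_
    rw [h, Real.sin_pi] at hsin
    exact lt_irrefl _ hsin

/-- A conformal map from the horizontal strip of height `π` onto the unit disc. -/
noncomputable def stripToDisc (z : ℂ) : ℂ :=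
  (Complex.I - Complex.exp z) / (Complex.I + Complex.exp z)

/-- The inverse of `stripToDisc` on the unit disc. -/
noncomputable def discToStrip (v : ℂ) : ℂ := Complex.log (Complex.I * ((1 - v) / (1 + v)))

theorem im_exp_pos {z : ℂ} (hz : z ∈ horizontalStrip) : 0 < (Complex.exp z).im := by
  rw [Complex.exp_im]
  exact mul_pos (Real.exp_pos _) (Real.sin_pos_of_mem_Ioo hz)

theorem I_add_exp_ne_zero {z : ℂ} (hz : z ∈ horizontalStrip) :
    Complex.I + Complex.exp z ≠ 0 := fun h ↦ by
  have h1 := congrArg Complex.im h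
  simp only [Complex.add_im, Complex.I_im, Complex.zero_im] at h1
  linarith [im_exp_pos hz]

theorem one_add_ne_zero_of_mem_ball {v : ℂ} (hv : v ∈ ball (0 : ℂ) 1) : 1 + v ≠ 0 := fun h ↦ by
  rw [mem_ball_zero_iff, ← neg_eq_of_add_eq_zero_right h] at hv
  simp at hv

theorem im_I_mul_pos {v : ℂ} (hv : v ∈ ball (0 : ℂ) 1) :
    0 < (Complex.I * ((1 - v) / (1 + v))).im := by
  have h0 := one_add_ne_zero_of_mem_ball hv
  have hn : 0 < Complex.normSq (1 + v) := Complex.normSq_pos.2 h0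
  have hv1 : Complex.normSq v < 1 := by
    rw [Complex.normSq_eq_norm_sq]
    have := mem_ball_zero_iff.1 hv
    nlinarith [norm_nonneg v]
  rw [Complex.I_mul_im, Complex.div_re, ← add_div]
  refine div_pos ?_ hn
  rw [Complex.normSq_apply] at hv1
  simp only [Complex.sub_re, Complex.add_re, Complex.sub_im, Complex.add_im, Complex.one_re,
    Complex.one_im]
  nlinarith

theorem mapsTo_stripToDisc : MapsTo stripToDisc horizontalStrip (ball 0 1) := by
  intro z hz
  have h1 := im_exp_pos hz
  rw [mem_ball_zero_iff, stripToDisc, norm_div,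
    div_lt_one (norm_pos_iff.2 (I_add_exp_ne_zero hz))]
  refine lt_of_pow_lt_pow_left₀ 2 (norm_nonneg _) ?_
  rw [← Complex.normSq_eq_norm_sq, ← Complex.normSq_eq_norm_sq, Complex.normSq_apply,
    Complex.normSq_apply]
  simp only [Complex.sub_re, Complex.add_re, Complex.sub_im, Complex.add_im, Complex.I_re,
    Complex.I_im]
  nlinarith

theorem mapsTo_discToStrip : MapsTo discToStrip (ball 0 1) horizontalStrip := fun v hv ↦ by
  rw [horizontalStrip, mem_ofPred_eq, discToStrip, Complex.log_im]
  exact Complex.arg_mem_Ioo_of_im_pos (im_I_mul_pos hv)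

theorem stripToDisc_discToStrip {v : ℂ} (hv : v ∈ ball (0 : ℂ) 1) :
    stripToDisc (discToStrip v) = v := by
  have h0 := one_add_ne_zero_of_mem_ball hv
  have h1 : Complex.I * ((1 - v) / (1 + v)) ≠ 0 := fun h ↦ by
    have := im_I_mul_pos hv
    simp [h] at this
  have h2 := I_add_exp_ne_zero (mapsTo_discToStrip hv)
  rw [stripToDisc]
  rw [discToStrip, Complex.exp_log h1] at h2 ⊢
  rw [div_eq_iff h2]
  field_simp
  ring

theorem discToStrip_stripToDisc {z : ℂ} (hz : z ∈ horizontalStrip) :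
    discToStrip (stripToDisc z) = z := by
  have h0 := I_add_exp_ne_zero hz
  have h1 : Complex.I * ((1 - stripToDisc z) / (1 + stripToDisc z)) = Complex.exp z := by
    have h2 := one_add_ne_zero_of_mem_ball (mapsTo_stripToDisc hz)
    rw [← mul_div_assoc, div_eq_iff h2, stripToDisc]
    field_simp
    ring
  rw [discToStrip, h1, Complex.log_exp (by linarith [hz.1, Real.pi_pos]) hz.2.le]

theorem differentiableOn_stripToDisc : DifferentiableOn ℂ stripToDisc horizontalStrip := by
  refine DifferentiableOn.div ?_ ?_ fun z hz ↦ I_add_exp_ne_zero hz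
  · exact ((differentiable_const _).sub Complex.differentiable_exp).differentiableOn
  · exact ((differentiable_const _).add Complex.differentiable_exp).differentiableOn

theorem continuousOn_discToStrip : ContinuousOn discToStrip (ball 0 1) := by
  refine ContinuousOn.clog ?_ fun v hv ↦
    Complex.mem_slitPlane_iff.2 (Or.inr (im_I_mul_pos hv).ne')
  exact continuousOn_const.mul ((by fun_prop : Continuous fun v : ℂ ↦ 1 - v).continuousOn.div
    (by fun_prop : Continuous fun v : ℂ ↦ 1 + v).continuousOn
    fun v hv ↦ one_add_ne_zero_of_mem_ball hv)

theorem tendsto_re_discToStrip :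
    Tendsto (fun v ↦ (discToStrip v).re) (𝓝[ball 0 1] 1) atBot := by
  have h1 : Tendsto (fun v : ℂ ↦ ‖Complex.I * ((1 - v) / (1 + v))‖) (𝓝[ball 0 1] 1) (𝓝[>] 0) := by
    refine tendsto_nhdsWithin_iff.2 ⟨?_, eventually_mem_nhdsWithin.mono fun v hv ↦ ?_⟩
    · have : ContinuousAt (fun v : ℂ ↦ ‖Complex.I * ((1 - v) / (1 + v))‖) 1 := by
        refine ContinuousAt.norm (continuousAt_const.mul (ContinuousAt.div (by fun_prop)
          (by fun_prop) (by norm_num)))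
      have h2 := this.tendsto
      simp only [sub_self, zero_div, mul_zero, norm_zero] at h2
      exact h2.mono_left nhdsWithin_le_nhds
    · refine norm_pos_iff.2 fun h ↦ ?_
      have := im_I_mul_pos hv
      simp [h] at this
  simpa only [discToStrip, Complex.log_re, Function.comp_def] using
    Real.tendsto_log_nhdsGT_zero.comp h1

theorem exists_tendsto_nhdsWithin_one {W : Set ℂ} {g k : ℂ → ℂ} (hWb : Bornology.IsBounded W)
    (hW : IsOpen W) (hWc : IsPreconnected W) (hg : DifferentiableOn ℂ g (ball 0 1))
    (hk : ContinuousOn k W) (hkW : MapsTo k W (ball 0 1)) (hgW : MapsTo g (ball 0 1) W)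
    (hgk : ∀ x ∈ W, g (k x) = x) (hkg : ∀ v ∈ ball 0 1, k (g v) = v) {a : ℝ} (ha : 0 < a)
    {η : ℝ → ℝ} (hη : IsCaratheodoryModulus W (g 0) a η) (hη0 : Tendsto η (𝓝[>] 0) (𝓝 0)) :
    ∃ y, Tendsto g (𝓝[ball 0 1] 1) (𝓝 y) := by
  have hne : (𝓝[ball 0 1] (1 : ℂ)).NeBot := by
    rw [← mem_closure_iff_nhdsWithin_neBot, closure_ball _ one_ne_zero]
    simp
  have h0 : stripToDisc (discToStrip 0) = 0 := stripToDisc_discToStrip (mem_ball_self one_pos)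
  refine cauchy_map_iff_exists_tendsto.1 (Metric.cauchy_iff.2 ⟨inferInstance, fun ε hε ↦ ?_⟩)
  obtain ⟨M, hM⟩ := exists_forall_re_lt_dist_le (h := g ∘ stripToDisc) (k := discToStrip ∘ k)
    hWb hW hWc (hg.comp differentiableOn_stripToDisc mapsTo_stripToDisc)
    (continuousOn_discToStrip.comp hk hkW) (mapsTo_discToStrip.comp hkW)
    (hgW.comp mapsTo_stripToDisc)
    (fun x hx ↦ by simp [stripToDisc_discToStrip (hkW hx), hgk x hx])
    (fun z hz ↦ by simp [hkg _ (mapsTo_stripToDisc hz), discToStrip_stripToDisc hz])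
    (mapsTo_discToStrip (mem_ball_self one_pos)) ha
    (by simpa only [Function.comp_apply, h0] using hη) hη0 (half_pos hε)
  refine ⟨g '' {v | v ∈ ball 0 1 ∧ (discToStrip v).re < M}, image_mem_map
    (eventually_mem_nhdsWithin.and (tendsto_re_discToStrip.eventually_lt_atBot M)), ?_⟩
  rintro _ ⟨u, ⟨hu, huM⟩, rfl⟩ _ ⟨v, ⟨hv, hvM⟩, rfl⟩
  have := hM _ (mapsTo_discToStrip hu) _ (mapsTo_discToStrip hv) huM hvM
  simp only [Function.comp_apply, stripToDisc_discToStrip hu, stripToDisc_discToStrip hv] at this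
  linarith

theorem exists_tendsto_nhdsWithin_of_norm_eq_one {W : Set ℂ} {g k : ℂ → ℂ}
    (hWb : Bornology.IsBounded W)
    (hW : IsOpen W) (hWc : IsPreconnected W) (hg : DifferentiableOn ℂ g (ball 0 1))
    (hk : ContinuousOn k W) (hkW : MapsTo k W (ball 0 1)) (hgW : MapsTo g (ball 0 1) W)
    (hgk : ∀ x ∈ W, g (k x) = x) (hkg : ∀ v ∈ ball 0 1, k (g v) = v) {a : ℝ} (ha : 0 < a)
    {η : ℝ → ℝ} (hη : IsCaratheodoryModulus W (g 0) a η) (hη0 : Tendsto η (𝓝[>] 0) (𝓝 0))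
    {ζ : ℂ} (hζ : ‖ζ‖ = 1) :
    ∃ y, Tendsto g (𝓝[ball 0 1] ζ) (𝓝 y) := by
  have hζ0 : ζ ≠ 0 := norm_ne_zero_iff.1 (by rw [hζ]; exact one_ne_zero)
  have hmul : MapsTo (fun v ↦ ζ * v) (ball 0 1) (ball 0 1) := fun v hv ↦ by
    simpa [hζ] using hv
  have hinv : MapsTo (fun v ↦ ζ⁻¹ * v) (ball 0 1) (ball 0 1) := fun v hv ↦ by
    simpa [hζ] using hv
  obtain ⟨y, hy⟩ := exists_tendsto_nhdsWithin_one (g := fun v ↦ g (ζ * v))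
    (k := fun x ↦ ζ⁻¹ * k x) hWb hW hWc
    (hg.comp (by fun_prop : Differentiable ℂ fun v ↦ ζ * v).differentiableOn hmul)
    (continuousOn_const.mul hk) (hinv.comp hkW) (hgW.comp hmul)
    (fun x hx ↦ by simp [mul_inv_cancel_left₀ hζ0, hgk x hx])
    (fun v hv ↦ by simp [hkg _ (hmul hv), inv_mul_cancel_left₀ hζ0]) ha
    (by simpa only [mul_zero] using hη) hη0
  refine ⟨y, ?_⟩
  have h1 : Tendsto (fun v ↦ ζ⁻¹ * v) (𝓝[ball 0 1] ζ) (𝓝[ball 0 1] 1) := by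
    refine tendsto_nhdsWithin_iff.2 ⟨?_, eventually_mem_nhdsWithin.mono fun v hv ↦ hinv hv⟩
    have := (by fun_prop : Continuous fun v : ℂ ↦ ζ⁻¹ * v).tendsto ζ
    rw [inv_mul_cancel₀ hζ0] at this
    exact this.mono_left nhdsWithin_le_nhds
  refine (hy.comp h1).congr fun v ↦ ?_
  simp [mul_inv_cancel_left₀ hζ0]

theorem locallyConnectedSpace_frontier {W : Set ℂ} {g k : ℂ → ℂ} (hW : IsOpen W)
    (hg : ContinuousOn g (ball 0 1)) (hk : ContinuousOn k W) (hkW : MapsTo k W (ball 0 1))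
    (hgW : MapsTo g (ball 0 1) W) (hgk : ∀ x ∈ W, g (k x) = x)
    (hkg : ∀ v ∈ ball 0 1, k (g v) = v)
    (hlim : ∀ ζ : ℂ, ‖ζ‖ = 1 → ∃ y, Tendsto g (𝓝[ball 0 1] ζ) (𝓝 y)) :
    LocallyConnectedSpace (frontier W) := by
  have hcl : closure (ball (0 : ℂ) 1) = closedBall 0 1 := closure_ball _ one_ne_zero
  have hlim' (x : ℂ) (hx : x ∈ closedBall 0 1) : ∃ y, Tendsto g (𝓝[ball 0 1] x) (𝓝 y) := by
    rcases (mem_closedBall_zero_iff.1 hx).lt_or_eq with h | h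
    · exact ⟨g x, hg x (mem_ball_zero_iff.2 h)⟩
    · exact hlim x h
  set G := extendFrom (ball 0 1) g with hG
  have hGc : ContinuousOn G (closedBall 0 1) := continuousOn_extendFrom hcl.ge hlim'
  have hGg {x : ℂ} (hx : x ∈ ball 0 1) : G x = g x :=
    extendFrom_eq (subset_closure hx) (hg x hx)
  have hGfr (ζ : ℂ) (hζ : ‖ζ‖ = 1) : G ζ ∈ frontier W := by
    obtain ⟨y, hy⟩ := hlim ζ hζ
    have hmem : ζ ∈ closure (ball (0 : ℂ) 1) := by
      rw [hcl, mem_closedBall_zero_iff, hζ]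
    have hne := mem_closure_iff_nhdsWithin_neBot.1 hmem
    rw [hG, extendFrom_eq hmem hy, hW.frontier_eq]
    refine ⟨mem_closure_of_tendsto hy (eventually_mem_nhdsWithin.mono hgW), ?_⟩
    refine notMem_of_tendsto (u := fun v ↦ v) hW hk hkW hkg eventually_mem_nhdsWithin
      (z := ζ) nhdsWithin_le_nhds ?_ hy
    rw [mem_ball_zero_iff, hζ]
    exact lt_irrefl 1
  have hsub : closure W ⊆ G '' closedBall 0 1 := by
    refine closure_minimal (fun x hx ↦ ⟨k x, ball_subset_closedBall (hkW hx), ?_⟩)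
      ((isCompact_closedBall 0 1).image_of_continuousOn hGc).isClosed
    rw [hGg (hkW hx), hgk x hx]
  let f : Circle → frontier W := fun ζ ↦ ⟨G ζ, hGfr ζ ζ.norm_coe⟩
  have hf : Continuous f := by
    refine Continuous.subtype_mk (hGc.comp_continuous (by fun_prop) fun ζ ↦ ?_) _
    rw [mem_closedBall_zero_iff, ζ.norm_coe]
  have hsurj : Function.Surjective f := by
    rintro ⟨y, hy⟩
    obtain ⟨x, hx, rfl⟩ := hsub (frontier_subset_closure hy)
    have hx1 : ‖x‖ = 1 := by
      refine (mem_closedBall_zero_iff.1 hx).eq_of_not_lt fun h ↦ ?_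
      have hxb := mem_ball_zero_iff.2 h
      rw [hW.frontier_eq, hGg hxb] at hy
      exact hy.2 (hgW hxb)
    exact ⟨⟨x, mem_sphere_zero_iff_norm.2 hx1⟩, rfl⟩
  have : LocallyConnectedSpace (EuclideanSpace ℝ (Fin 1)) := inferInstance
  have : LocallyConnectedSpace Circle :=
    ChartedSpace.locallyConnectedSpace (EuclideanSpace ℝ (Fin 1)) Circle
  exact (hf.isClosedMap.isQuotientMap hf hsurj).isCoinducing.locallyConnectedSpace

end

/-- There is a Carathéodory modulus tending to `0` at `0⁺` iff the boundary
of `W` is locally connected. -/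
theorem caratheodoryModulus_iff_locallyConnected
    (W : Set ℂ) (hWb : Bornology.IsBounded W) (hWo : IsOpen W)
    (hWc : IsConnected W) (hWsc : SimplyConnectedSpace W)
    (w : ℂ) (hw : w ∈ W) :
    (∃ a > 0, ∃ η : ℝ → ℝ, IsCaratheodoryModulus W w a η ∧
        Filter.Tendsto η (nhdsWithin 0 (Set.Ioi 0)) (nhds 0)) ↔
      LocallyConnectedSpace (frontier W) := by
  constructor
  · rintro ⟨a, ha, η, hη, hη0⟩
    obtain ⟨g, k, hg, hk, hgW, hkW, hgk, hkg, rfl⟩ :=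
      exists_riemann_map hWb hWo hWc.isPreconnected hWsc hw
    exact locallyConnectedSpace_frontier hWo hg.continuousOn hk.continuousOn hkW hgW hgk hkg
      fun ζ hζ ↦ exists_tendsto_nhdsWithin_of_norm_eq_one hWb hWo hWc.isPreconnected hg
        hk.continuousOn hkW hgW hgk hkg ha hη hη0 hζ
  · exact exists_caratheodoryModulus hWb hWo hWc.isPreconnected hw
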